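/- arXiv:1802.06972 — 8 statements merged into one kernel-verified Lean document; each statement's English description precedes it below -/
import Mathlib

section
/- Fix a positive integer k. For integers m with 2k ≤ m, let b(m,k) denote the minimal base size of the symmetric group Sym(m) acting on the set Ω(m,k) of all k-element subsets of {1,…,m}, where |Ω(m,k)| = C(m,k). Then, as m → ∞, the quantity b(m,k)·log C(m,k) / log(m!) tends to 2k/(k+1). -/
open Pointwise

/-- A finite family of finsets that separates points has trivial pointwise stabilizer. -/
theorem perm_eq_one_of_separating {α : Type*} [DecidableEq α] {B : Finset (Finset α)}
    (hB : ∀ x y, (∀ s ∈ B, x ∈ s ↔ y ∈ s) → x = y)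
    (g : Equiv.Perm α) (hg : ∀ s ∈ B, g • s = s) : g = 1 := by
  refine Equiv.ext fun x => (hB (g x) x fun s hs => ?_)
  have h := Finset.smul_mem_smul_finset_iff (s := s) (b := x) g
  rwa [hg s hs, Equiv.Perm.smul_def] at h

/-- A finite family of finsets with trivial pointwise stabilizer separates points. -/
theorem separating_of_perm_eq_one {α : Type*} [DecidableEq α] {B : Finset (Finset α)}
    (hB : ∀ g : Equiv.Perm α, (∀ s ∈ B, g • s = s) → g = 1)
    (x y : α) (hxy : ∀ s ∈ B, x ∈ s ↔ y ∈ s) : x = y := by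
  rw [← Equiv.swap_eq_one_iff]
  refine hB _ fun s hs => ?_
  refine Finset.eq_of_subset_of_card_le (fun z hz => ?_) (by simp)
  obtain ⟨w, hw, rfl⟩ := Finset.mem_smul_finset.1 hz
  have h := hxy s hs
  rw [Equiv.Perm.smul_def, Equiv.swap_apply_def]
  split_ifs with h1 h2
  · exact h.1 (h1 ▸ hw)
  · exact h.2 (h2 ▸ hw)
  · exact hw

theorem sum_choose_mul_two_sub (c : ℕ) :
    ∑ j ∈ Finset.range (c + 1), c.choose j * (2 - j) = c + 2 := by
  cases c with
  | zero => simp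
  | succ n =>
    rw [Finset.sum_range_succ', Finset.sum_range_succ']
    have : ∀ j ∈ Finset.range n, (n + 1).choose (j + 1 + 1) * (2 - (j + 1 + 1)) = 0 := by
      intro j _
      rw [show 2 - (j + 1 + 1) = 0 by omega, mul_zero]
    rw [Finset.sum_eq_zero this]
    simp

/-- A separating family of `k`-subsets of an `m`-set has at least `2(m-1)/(k+1)` members. -/
theorem two_mul_card_le_of_separating {α : Type*} [Fintype α] [DecidableEq α] {k : ℕ}
    {B : Finset (Finset α)} (hk : ∀ s ∈ B, s.card = k)
    (hB : ∀ x y, (∀ s ∈ B, x ∈ s ↔ y ∈ s) → x = y) :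
    2 * Fintype.card α ≤ (k + 1) * B.card + 2 := by
  classical
  let σ : α → Finset (Finset α) := fun x => B.filter (x ∈ ·)
  have hσ : Function.Injective σ := fun x y h => hB x y fun s hs => by
    simpa [σ, hs] using Finset.ext_iff.1 h s
  have hdeg : ∑ x, (σ x).card = B.card * k := by
    have h := Finset.sum_card_bipartiteAbove_eq_sum_card_bipartiteBelow
      (s := (Finset.univ : Finset α)) (t := B) (fun x s => x ∈ s)
    rw [← Finset.sum_const_nat hk]
    simpa [Finset.bipartiteAbove, Finset.bipartiteBelow, σ] using h
  have hdef : ∑ x, (2 - (σ x).card) ≤ B.card + 2 := by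
    calc ∑ x, (2 - (σ x).card)
        = ∑ T ∈ Finset.univ.image σ, (2 - T.card) :=
          (Finset.sum_image (f := fun T : Finset (Finset α) => 2 - T.card) hσ.injOn).symm
      _ ≤ ∑ T ∈ B.powerset, (2 - T.card) := by
          refine Finset.sum_le_sum_of_subset fun T hT => ?_
          obtain ⟨x, -, rfl⟩ := Finset.mem_image.1 hT
          exact Finset.mem_powerset.2 (Finset.filter_subset _ _)
      _ = B.card + 2 := by
          rw [Finset.sum_powerset_apply_card (fun j => 2 - j)]
          simpa using sum_choose_mul_two_sub B.card
  have hsum : ∑ _x : α, 2 ≤ ∑ x, ((σ x).card + (2 - (σ x).card)) :=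
    Finset.sum_le_sum fun x _ => by omega
  rw [Finset.sum_add_distrib, hdeg, Finset.sum_const, Finset.card_univ, smul_eq_mul] at hsum
  linarith

/-- The pairs in block `j` that contain `i`: a star in a complete graph with loops. -/
def blockStar {t k : ℕ} (p : Fin t × Fin k) : Finset (Fin t × Sym2 (Fin k)) :=
  Finset.univ.image fun i => (p.1, s(p.2, i))

theorem mem_blockStar {t k : ℕ} {p : Fin t × Fin k} {q : Fin t × Sym2 (Fin k)} :
    q ∈ blockStar p ↔ q.1 = p.1 ∧ p.2 ∈ q.2 := by
  obtain ⟨j, z⟩ := q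
  simp only [blockStar, Finset.mem_image, Finset.mem_univ, true_and, Prod.mk.injEq, 
    Sym2.mem_iff_exists]
  constructor
  · rintro ⟨i, h, h'⟩
    exact ⟨h.symm, i, h'.symm⟩
  · rintro ⟨h, i, h'⟩
    exact ⟨i, h.symm, h'.symm⟩

theorem card_blockStar {t k : ℕ} (p : Fin t × Fin k) : (blockStar p).card = k := by
  rw [blockStar, Finset.card_image_of_injective, Finset.card_univ, Fintype.card_fin]
  intro a b h
  exact Sym2.congr_right.1 (Prod.ext_iff.1 h).2

/-- Disjoint complete graphs with loops, with leftover points individually marked, give a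
separating family of `k`-sets. -/
theorem exists_separating_family {k t : ℕ} (r : ℕ) (hk : 1 ≤ k) (ht : 1 ≤ t) :
    ∃ f : (Fin t × Fin k) ⊕ Fin r → Finset ((Fin t × Sym2 (Fin k)) ⊕ Fin r),
      (∀ i, (f i).card = k) ∧ ∀ x y, (∀ i, x ∈ f i ↔ y ∈ f i) → x = y := by
  classical
  obtain ⟨T, -, hT⟩ := Finset.exists_subset_card_eq (n := k - 1)
    (s := blockStar ((⟨0, ht⟩, ⟨0, hk⟩) : Fin t × Fin k)) (by rw [card_blockStar]; omega)
  refine ⟨Sum.elim (fun p => (blockStar p).map .inl)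
    (fun x => insert (Sum.inr x) (T.map .inl)), ?_, ?_⟩
  · rintro (p | x)
    · simp [card_blockStar]
    · rw [Sum.elim_inr, Finset.card_insert_of_notMem (by simp), Finset.card_map, hT]
      omega
  · have hne : ∀ (q : Fin t × Sym2 (Fin k)), ∃ p, q ∈ blockStar p := by
      rintro ⟨j, z⟩
      induction z with
      | h a b => exact ⟨(j, a), by simp [mem_blockStar]⟩
    rintro (q | x) (q' | y) h
    · have h' : ∀ p, q ∈ blockStar p ↔ q' ∈ blockStar p := fun p => by simpa using h (.inl p)
      simp only [mem_blockStar] at h'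
      obtain ⟨p, hp⟩ := hne q
      rw [mem_blockStar] at hp
      have h1 : q.1 = q'.1 := hp.1.trans ((h' p).1 hp).1.symm
      refine congrArg Sum.inl (Prod.ext h1 (Sym2.ext fun i => ?_))
      simpa [h1] using h' (q.1, i)
    · obtain ⟨p, hp⟩ := hne q
      simpa [hp] using h (.inl p)
    · obtain ⟨p, hp⟩ := hne q'
      simpa [hp] using h (.inl p)
    · simpa [eq_comm] using h (.inr x)

/-- The cardinalities of the bases of `Sym(m)` consisting of `k`-subsets. -/
def subsetBaseSizes (m k : ℕ) : Set ℕ :=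
  {c : ℕ | ∃ B : Finset (Finset (Fin m)), B.card = c ∧ (∀ s ∈ B, s.card = k) ∧
    ∀ g : Equiv.Perm (Fin m), (∀ s ∈ B, g • s = s) → g = 1}

theorem exists_mem_subsetBaseSizes {k t r m : ℕ} (hk : 1 ≤ k) (ht : 1 ≤ t)
    (hm : t * (k + 1).choose 2 + r = m) : ∃ c ∈ subsetBaseSizes m k, c ≤ t * k + r := by
  classical
  obtain ⟨f, hf, hsep⟩ := exists_separating_family r hk ht
  let e : (Fin t × Sym2 (Fin k)) ⊕ Fin r ≃ Fin m :=
    Fintype.equivFinOfCardEq (by simp [Sym2.card, hm])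
  refine ⟨_, ⟨Finset.univ.image fun i => (f i).map e.toEmbedding, rfl, ?_, ?_⟩, ?_⟩
  · intro s hs
    obtain ⟨i, -, rfl⟩ := Finset.mem_image.1 hs
    rw [Finset.card_map, hf]
  · refine perm_eq_one_of_separating fun x y h => e.symm.injective (hsep _ _ fun i => ?_)
    simpa [Finset.mem_map_equiv] using h _ (Finset.mem_image_of_mem _ (Finset.mem_univ i))
  · exact Finset.card_image_le.trans (by simp)

theorem sInf_subsetBaseSizes_bounds {k m : ℕ} (hk : 1 ≤ k) (hm : (k + 1).choose 2 ≤ m) :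
    2 * m ≤ (k + 1) * sInf (subsetBaseSizes m k) + 2 ∧
      (k + 1) * sInf (subsetBaseSizes m k) ≤ 2 * m + (k + 1) * (k + 1).choose 2 := by
  have hN : 0 < (k + 1).choose 2 := Nat.choose_pos (by omega)
  have hN2 : 2 * (k + 1).choose 2 = k * (k + 1) := by
    rw [Nat.choose_two_right, Nat.add_sub_cancel, Nat.mul_div_cancel' ?_, mul_comm]
    rw [mul_comm]
    exact (Nat.even_mul_succ_self k).two_dvd
  obtain ⟨c, hc, hle⟩ := exists_mem_subsetBaseSizes hk (Nat.div_pos hm hN)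
    (Nat.div_add_mod' m ((k + 1).choose 2))
  constructor
  · obtain ⟨B, hB, hBk, hBase⟩ := Nat.sInf_mem ⟨c, hc⟩
    have h := two_mul_card_le_of_separating hBk (separating_of_perm_eq_one hBase)
    rwa [hB, Fintype.card_fin] at h
  · have h1 := (Nat.sInf_le hc).trans hle
    have h2 := Nat.div_add_mod' m ((k + 1).choose 2)
    have h3 := (Nat.mod_lt m hN).le
    calc (k + 1) * sInf (subsetBaseSizes m k)
        ≤ (k + 1) * (m / (k + 1).choose 2 * k + m % (k + 1).choose 2) :=
          Nat.mul_le_mul_left _ h1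
      _ = 2 * (m / (k + 1).choose 2 * (k + 1).choose 2)
          + (k + 1) * (m % (k + 1).choose 2) := by
          rw [Nat.mul_left_comm, hN2]
          ring
      _ ≤ 2 * m + (k + 1) * (k + 1).choose 2 := by gcongr; omega

open Filter Topology

theorem tendsto_log_natCast_atTop : Tendsto (fun m : ℕ => Real.log m) atTop atTop :=
  Real.tendsto_log_atTop.comp tendsto_natCast_atTop_atTop

theorem tendsto_sInf_subsetBaseSizes_div {k : ℕ} (hk : 1 ≤ k) :
    Tendsto (fun m : ℕ => ((sInf (subsetBaseSizes m k) : ℕ) : ℝ) / m) atTop (𝓝 (2 / (k + 1))) := by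
  have hlim (a : ℝ) : Tendsto (fun m : ℕ => 2 / ((k : ℝ) + 1) + a / m) atTop
      (𝓝 (2 / (k + 1))) := by
    simpa using tendsto_const_nhds.add (tendsto_const_div_atTop_nhds_zero_nat a)
  refine tendsto_of_tendsto_of_tendsto_of_le_of_le' (hlim (-2 / (k + 1)))
    (hlim ((k + 1).choose 2)) ?_ ?_
  all_goals
    filter_upwards [eventually_ge_atTop ((k + 1).choose 2), eventually_gt_atTop 0] with m hm hm0
    obtain ⟨h1, h2⟩ := sInf_subsetBaseSizes_bounds hk hm
    have hmR : (0 : ℝ) < m := by exact_mod_cast hm0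
    have hkR : (0 : ℝ) < k + 1 := by positivity
    rify at h1 h2
  · rw [div_add_div _ _ hkR.ne' hmR.ne', div_le_div_iff₀ (by positivity) hmR]
    have : ((k : ℝ) + 1) * (-2 / (k + 1)) = -2 := by field_simp
    rw [this]
    nlinarith
  · rw [div_add_div _ _ hkR.ne' hmR.ne', div_le_div_iff₀ hmR (by positivity)]
    nlinarith

theorem tendsto_log_choose_div_log (k : ℕ) :
    Tendsto (fun m : ℕ => Real.log (m.choose k) / Real.log m) atTop (𝓝 k) := by
  have hratio : Tendsto (fun m : ℕ => (m.choose k : ℝ) / (m ^ k / k.factorial)) atTop (𝓝 1) := by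
    refine (Asymptotics.isEquivalent_iff_tendsto_one ?_).1 (isEquivalent_choose k)
    filter_upwards [eventually_gt_atTop 0] with m hm
    positivity
  have hlog := ((Real.continuousAt_log one_ne_zero).tendsto.comp hratio).sub_const
    (Real.log k.factorial)
  have h := (hlog.div_atTop tendsto_log_natCast_atTop).add_const (k : ℝ)
  rw [zero_add] at h
  refine h.congr' ?_
  filter_upwards [eventually_ge_atTop k, eventually_gt_atTop 1] with m hm hm1
  have hm0 : (m : ℝ) ≠ 0 := by positivity
  have hc : (m.choose k : ℝ) ≠ 0 := by exact_mod_cast (Nat.choose_pos hm).ne'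
  have hL : Real.log m ≠ 0 := (Real.log_pos (by exact_mod_cast hm1)).ne'
  have hf : (k.factorial : ℝ) ≠ 0 := by positivity
  simp only [Function.comp_apply]
  rw [Real.log_div hc (by positivity), Real.log_div (by positivity) hf, Real.log_pow]
  field_simp
  ring

theorem tendsto_log_factorial_div_mul_log :
    Tendsto (fun m : ℕ => Real.log m.factorial / (m * Real.log m)) atTop (𝓝 1) := by
  have hlow : Tendsto (fun m : ℕ => 1 - (Real.log m)⁻¹) atTop (𝓝 1) := by
    simpa using tendsto_const_nhds.sub tendsto_log_natCast_atTop.inv_tendsto_atTop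
  refine tendsto_of_tendsto_of_tendsto_of_le_of_le' hlow tendsto_const_nhds ?_ ?_
  all_goals
    filter_upwards [eventually_gt_atTop 1] with m hm
    have hm0 : (0 : ℝ) < m := by positivity
    have hL : 0 < Real.log m := Real.log_pos (by exact_mod_cast hm)
  · rw [le_div_iff₀ (by positivity)]
    have h := Stirling.le_log_factorial_stirling (n := m) (by omega)
    have hpi : 0 ≤ Real.log (2 * Real.pi) := Real.log_nonneg (by linarith [Real.pi_gt_three])
    have : (1 - (Real.log m)⁻¹) * (m * Real.log m) = m * Real.log m - m := by field_simp
    linarith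
  · rw [div_le_one (by positivity), ← Real.log_pow]
    exact Real.log_le_log (by positivity) (by exact_mod_cast Nat.factorial_le_pow m)

/-- Fix `k ≥ 1`. Let `b(m,k)` be the minimal base size of `Sym(m)`
acting on the `k`-element subsets of `{1,…,m}`. Then, as `m → ∞`,
`b(m,k) · log C(m,k) / log (m!) → 2k/(k+1)`. -/
theorem base_size_subsets_tendsto (k : ℕ) (hk : 1 ≤ k) :
    Filter.Tendsto (fun m : ℕ =>
      ((sInf {c : ℕ | ∃ B : Finset (Finset (Fin m)), B.card = c ∧
          (∀ s ∈ B, s.card = k) ∧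
          ∀ g : Equiv.Perm (Fin m), (∀ s ∈ B, g • s = s) → g = 1} : ℕ) : ℝ) *
        Real.logb 2 (m.choose k) / Real.logb 2 (m.factorial))
      Filter.atTop (nhds (2 * k / (k + 1))) := by
  have h := ((tendsto_sInf_subsetBaseSizes_div hk).mul (tendsto_log_choose_div_log k)).div
    tendsto_log_factorial_div_mul_log one_ne_zero
  rw [div_one, div_mul_eq_mul_div] at h
  refine h.congr' ?_
  filter_upwards [eventually_gt_atTop 1] with m hm
  have hm0 : (m : ℝ) ≠ 0 := by positivity
  have hL : Real.log m ≠ 0 := (Real.log_pos (by exact_mod_cast hm)).ne'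
  have h2 : Real.log 2 ≠ 0 := (Real.log_pos one_lt_two).ne'
  change _ = ((sInf (subsetBaseSizes m k) : ℕ) : ℝ) * _ / _
  simp only [Real.logb, Pi.div_apply]
  field_simp
end

section
/- Let F be a finite field and let V be a finite-dimensional F-vector space of even dimension d equipped with a nondegenerate alternating bilinear form β, and let Sp(V) = {g ∈ GL(V) : β(g x, g y) = β(x,y) for all x,y ∈ V} be the symplectic group acting naturally on V. Then the minimal base size of Sp(V) acting on V equals d; that is, there is a subset of V of size d whose pointwise stabilizer in Sp(V) is trivial, and every subset of V of size at most d−1 is fixed pointwise by some non-identity element of Sp(V). -/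
/-- The transvection `x ↦ x + β v x • v` attached to an alternating bilinear form. -/
def alternatingTransvection {F V : Type*} [Field F] [AddCommGroup V] [Module F V]
    (β : V →ₗ[F] V →ₗ[F] F) (v : V) (hv : β v v = 0) : V ≃ₗ[F] V where
  toFun x := x + β v x • v
  map_add' x y := by
    rw [map_add, add_smul]
    abel
  map_smul' c x := by simp [smul_smul]
  invFun x := x - β v x • v
  left_inv x := by simp [hv]
  right_inv x := by simp [hv]

theorem alternatingTransvection_apply {F V : Type*} [Field F] [AddCommGroup V] [Module F V]
    (β : V →ₗ[F] V →ₗ[F] F) (v : V) (hv : β v v = 0) (x : V) :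
    alternatingTransvection β v hv x = x + β v x • v := rfl

theorem alternatingTransvection_isometry {F V : Type*} [Field F] [AddCommGroup V] [Module F V]
    (β : V →ₗ[F] V →ₗ[F] F) (halt : ∀ x, β x x = 0) (v x y : V) :
    β (alternatingTransvection β v (halt v) x) (alternatingTransvection β v (halt v) y) =
      β x y := by
  have hneg : β x v = -β v x := (LinearMap.IsAlt.neg (B := β) halt v x).symm
  simp only [alternatingTransvection_apply, map_add, map_smul, LinearMap.add_apply,
    LinearMap.smul_apply, smul_eq_mul, halt v, hneg]
  ring

/-- In a space with a nondegenerate form, a proper subspace is orthogonal to a nonzero vector. -/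
theorem exists_ne_zero_orthogonal_of_lt_top {F V : Type*} [Field F] [AddCommGroup V]
    [Module F V] [FiniteDimensional F V] (β : V →ₗ[F] V →ₗ[F] F)
    (hnd : ∀ x, (∀ y, β x y = 0) → x = 0) (W : Submodule F V) (hW : W < ⊤) :
    ∃ v : V, v ≠ 0 ∧ ∀ w ∈ W, β v w = 0 := by
  obtain ⟨f, hf, hWf⟩ := W.exists_le_ker_of_lt_top hW
  have hinj : Function.Injective β := by
    rw [injective_iff_map_eq_zero]
    intro x hx
    exact hnd x fun y => by simp [hx]
  have hsurj : Function.Surjective β :=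
    (LinearMap.injective_iff_surjective_of_finrank_eq_finrank
      (Subspace.dual_finrank_eq (K := F) (V := V)).symm).1 hinj
  obtain ⟨v, rfl⟩ := hsurj f
  exact ⟨v, fun h => hf (by simp [h]), fun w hw => hWf hw⟩


/-- For a nondegenerate alternating bilinear form `β` on a
`d`-dimensional vector space `V` (`d` even) over a finite field `F`, the minimal base
size of the symplectic group `Sp(V)` acting naturally on `V` equals `d`: there is a
subset of `V` of size `d` whose pointwise stabilizer in `Sp(V)` is trivial, and every
subset of size at most `d − 1` is fixed pointwise by some non-identity element of
`Sp(V)`. -/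
theorem base_size_symplectic_eq_dim {F V : Type*} [Field F] [Fintype F]
    [AddCommGroup V] [Module F V] [FiniteDimensional F V]
    (d : ℕ) (hd : Even d) (hdim : Module.finrank F V = d)
    (β : V →ₗ[F] V →ₗ[F] F)
    (halt : ∀ x, β x x = 0)
    (hnd : ∀ x, (∀ y, β x y = 0) → x = 0) :
    (∃ B : Finset V, B.card = d ∧
      ∀ g : V ≃ₗ[F] V, (∀ x y, β (g x) (g y) = β x y) →
        (∀ v ∈ B, g v = v) → g = LinearEquiv.refl F V) ∧
    (∀ B : Finset V, B.card < d →
      ∃ g : V ≃ₗ[F] V, (∀ x y, β (g x) (g y) = β x y) ∧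
        (∀ v ∈ B, g v = v) ∧ g ≠ LinearEquiv.refl F V) := by
  classical
  constructor
  · let b := Module.finBasisOfFinrankEq F V hdim
    refine ⟨Finset.univ.image b, ?_, fun g _ hg => ?_⟩
    · simp [Finset.card_image_of_injective _ b.injective]
    · exact b.ext' fun i => hg (b i) (by simp)
  · intro B hB
    have hW : Submodule.span F (B : Set V) < ⊤ := by
      refine lt_top_iff_ne_top.2 fun h => ?_
      have := finrank_span_finset_le_card (R := F) B
      rw [Set.finrank, h, finrank_top, hdim] at this
      omega
    obtain ⟨v, hv, hvB⟩ := exists_ne_zero_orthogonal_of_lt_top β hnd _ hW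
    refine ⟨alternatingTransvection β v (halt v), alternatingTransvection_isometry β halt v,
      fun w hw => ?_, fun h => hv (hnd v fun y => ?_)⟩
    · simp [alternatingTransvection_apply, hvB w (Submodule.subset_span hw)]
    · have hy := LinearEquiv.congr_fun h y
      simpa [alternatingTransvection_apply, hv] using hy
end

section
/- Fix an even integer d ≥ 2. There exists a constant Q such that for every finite field F with |F| ≥ Q the following holds. Let V = F^d carry a nondegenerate alternating bilinear form β, let Sp(V) be the group of F-linear automorphisms of V preserving β, and let G be the group of affine permutations of V of the form v ↦ g(v) + t with g ∈ Sp(V) and t ∈ V, acting on V (so the degree is n = |F|^d). Then the minimal base size of G acting on V equals round(2·log|G| / log n) − 2, where round denotes the nearest integer. -/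
theorem Nat.card_le_mul_card_of_fiber_le {α γ : Type*} [Finite α] [Finite γ] (f : α → γ) (n : ℕ)
    (h : ∀ c, Nat.card {a // f a = c} ≤ n) : Nat.card α ≤ n * Nat.card γ := by
  classical
  have := Fintype.ofFinite α
  have := Fintype.ofFinite γ
  rw [Nat.card_eq_fintype_card, Nat.card_eq_fintype_card, ← Finset.card_univ, ← Finset.card_univ]
  refine Finset.card_le_mul_card_image_of_maps_to (f := f) (fun _ _ => Finset.mem_univ _) n ?_
  intro c _
  have := h c
  rwa [Nat.card_eq_fintype_card, Fintype.card_subtype] at this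

section Form

variable {F V : Type*} [Field F] [AddCommGroup V] [Module F V]

theorem LinearMap.card_affine_isometry (β : LinearMap.BilinForm F V) :
    Nat.card {π : Equiv.Perm V // ∃ g : V ≃ₗ[F] V,
      (∀ x y, β (g x) (g y) = β x y) ∧ ∃ t, ∀ v, π v = g v + t} =
    Nat.card {g : V ≃ₗ[F] V // ∀ x y, β (g x) (g y) = β x y} * Nat.card V := by
  rw [← Nat.card_prod]
  refine (Nat.card_eq_of_bijective
    (fun p => ⟨p.1.1.toEquiv.trans (Equiv.addRight p.2), p.1.1, p.1.2, p.2, fun v => rfl⟩)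
    ⟨?_, ?_⟩).symm
  · rintro ⟨⟨g, hg⟩, t⟩ ⟨⟨g', hg'⟩, t'⟩ h
    have h' : ∀ v, g v + t = g' v + t' := fun v => Equiv.congr_fun (congrArg Subtype.val h) v
    have ht : t = t' := by simpa using h' 0
    subst ht
    have : g = g' := LinearEquiv.ext fun v => add_right_cancel (h' v)
    subst this
    rfl
  · rintro ⟨π, g, hg, t, ht⟩
    exact ⟨⟨⟨g, hg⟩, t⟩, Subtype.ext (Equiv.ext fun v => (ht v).symm)⟩

variable [Finite V]

instance LinearEquiv.finite_of_finite : Finite (V ≃ₗ[F] V) :=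
  Finite.of_injective (fun g : V ≃ₗ[F] V => (g : V → V)) DFunLike.coe_injective

theorem LinearMap.finrank_add_finrank_orthogonal_of_ker_eq_bot (β : LinearMap.BilinForm F V)
    (hker : LinearMap.ker β = ⊥) (W : Submodule F V) :
    Module.finrank F W + Module.finrank F (LinearMap.BilinForm.orthogonal β W) =
      Module.finrank F V := by
  have := LinearMap.BilinForm.finrank_add_finrank_orthogonal' (B := β) W
  rwa [hker, inf_bot_eq, finrank_bot, add_zero] at this

theorem LinearMap.card_prescribed_pairing_le (β : LinearMap.BilinForm F V)
    (hker : LinearMap.ker β = ⊥) {k : ℕ} (u : Fin k → V) (hu : LinearIndependent F u)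
    (c : Fin k → F) :
    Nat.card {x : V // ∀ i, β (u i) x = c i} * Nat.card F ^ k ≤ Nat.card V := by
  rcases isEmpty_or_nonempty {x : V // ∀ i, β (u i) x = c i} with h | ⟨⟨x₀, hx₀⟩⟩
  · simp
  set W := LinearMap.BilinForm.orthogonal β (Submodule.span F (Set.range u)) with hW
  have hle : Nat.card {x : V // ∀ i, β (u i) x = c i} ≤ Nat.card W := by
    refine Nat.card_le_card_of_injective
      (fun x => (⟨x.1 - x₀, ?_⟩ : W)) ?_
    · rw [hW, LinearMap.BilinForm.mem_orthogonal_iff]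
      intro y hy
      change β y (x.1 - x₀) = 0
      induction hy using Submodule.span_induction with
      | mem y hy =>
        obtain ⟨i, rfl⟩ := hy
        rw [map_sub, x.2 i, hx₀ i, sub_self]
      | zero => simp
      | add y z _ _ hy hz => rw [map_add, LinearMap.add_apply, hy, hz, add_zero]
      | smul a y _ hy => rw [map_smul, LinearMap.smul_apply, hy, smul_zero]
    · intro x y hxy
      exact Subtype.ext (sub_left_injective (congrArg Subtype.val hxy))
  have hfin := LinearMap.finrank_add_finrank_orthogonal_of_ker_eq_bot β hker
    (Submodule.span F (Set.range u))
  rw [finrank_span_eq_card hu, Fintype.card_fin, ← hW] at hfin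
  calc _ ≤ Nat.card W * Nat.card F ^ k := Nat.mul_le_mul_right _ hle
    _ = Nat.card V := by
      rw [Module.natCard_eq_pow_finrank (K := F) (V := W),
        Module.natCard_eq_pow_finrank (K := F) (V := V), ← pow_add, add_comm, hfin]

theorem LinearMap.exists_affine_isometry_fixing (β : LinearMap.BilinForm F V)
    (halt : ∀ x, β x x = 0) (hker : LinearMap.ker β = ⊥) (B : Finset V)
    (hB : B.card ≤ Module.finrank F V) (hV : 0 < Module.finrank F V) :
    ∃ π : Equiv.Perm V, (∃ g : V ≃ₗ[F] V,
      (∀ x y, β (g x) (g y) = β x y) ∧ ∃ t, ∀ v, π v = g v + t) ∧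
      (∀ v ∈ B, π v = v) ∧ π ≠ 1 := by
  classical
  have hneg : ∀ x y, β x y = - β y x := fun x y => (LinearMap.IsAlt.neg (B := β) halt y x).symm
  obtain ⟨b₀, hb₀⟩ : ∃ b₀, B.Nonempty → b₀ ∈ B := by
    rcases B.eq_empty_or_nonempty with rfl | ⟨b, hb⟩
    · exact ⟨0, by simp⟩
    · exact ⟨b, fun _ => hb⟩
  let D : Finset V := (B.erase b₀).image (· - b₀)
  have hD : D.card < Module.finrank F V := by
    refine Finset.card_image_le.trans_lt ?_
    rcases B.eq_empty_or_nonempty with rfl | h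
    · simpa using hV
    · exact (Finset.card_erase_lt_of_mem (hb₀ h)).trans_le hB
  set W := Submodule.span F (D : Set V)
  have hW := (finrank_span_finset_le_card (R := F) D).trans_lt hD
  have hfin := LinearMap.finrank_add_finrank_orthogonal_of_ker_eq_bot β hker W
  have hpos : 0 < Module.finrank F (LinearMap.BilinForm.orthogonal β W) := by
    change Module.finrank F W < _ at hW
    omega
  obtain ⟨⟨a, ha⟩, ha0⟩ := Module.finrank_pos_iff_exists_ne_zero.1 hpos
  have ha0 : a ≠ 0 := fun h => ha0 (Subtype.ext h)
  rw [LinearMap.BilinForm.mem_orthogonal_iff] at ha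
  have hfix : ∀ v ∈ B, β a (v - b₀) = 0 := by
    intro v hv
    by_cases hvb : v = b₀
    · simp [hvb]
    · rw [hneg, neg_eq_zero]
      exact ha _ (Submodule.subset_span
        (Finset.mem_coe.2 (Finset.mem_image_of_mem _ (Finset.mem_erase.2 ⟨hvb, hv⟩))))
  let g : V ≃ₗ[F] V := LinearEquiv.transvection (f := β a) (v := a) (halt a)
  have hg : ∀ v, g v = v + β a v • a := fun v => rfl
  have hπ : ∀ v, (g.toEquiv.trans (Equiv.addRight (b₀ - g b₀))) v = v + β a (v - b₀) • a := by
    intro v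
    change g v + (b₀ - g b₀) = _
    rw [hg, hg, map_sub, sub_smul]
    abel
  refine ⟨g.toEquiv.trans (Equiv.addRight (b₀ - g b₀)), ⟨g, ?_, _, fun v => rfl⟩, ?_, ?_⟩
  · intro x y
    simp only [hg, map_add, map_smul, LinearMap.add_apply, LinearMap.smul_apply, halt, smul_eq_mul]
    rw [hneg x a]
    ring
  · intro v hv
    rw [hπ, hfix v hv, zero_smul, add_zero]
  · intro h1
    refine ha0 ((LinearMap.ker_eq_bot'.1 hker) a (LinearMap.ext fun v => ?_))
    have h2 := hπ (v + b₀)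
    rw [h1, Equiv.Perm.one_apply, add_sub_cancel_right, left_eq_add, smul_eq_zero] at h2
    simpa [ha0] using h2

theorem LinearMap.sInf_card_base_affine_isometry (β : LinearMap.BilinForm F V)
    (halt : ∀ x, β x x = 0) (hker : LinearMap.ker β = ⊥) {d : ℕ} (hd : 0 < d)
    (b : Module.Basis (Fin d) F V) :
    sInf {c : ℕ | ∃ B : Finset V, B.card = c ∧ ∀ π : Equiv.Perm V,
      (∃ g : V ≃ₗ[F] V, (∀ x y, β (g x) (g y) = β x y) ∧ ∃ t, ∀ v, π v = g v + t) →
      (∀ v ∈ B, π v = v) → π = 1} = d + 1 := by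
  classical
  have hrank : Module.finrank F V = d := by simp [Module.finrank_eq_card_basis b]
  refine IsLeast.csInf_eq ⟨⟨insert 0 (Finset.univ.image b), ?_, ?_⟩, ?_⟩
  · rw [Finset.card_insert_of_notMem, Finset.card_image_of_injective _ b.injective]
    · simp
    · simpa using fun i => b.ne_zero i
  · rintro π ⟨g, -, t, ht⟩ hfix
    have ht0 : t = 0 := by
      have := hfix 0 (by simp)
      rwa [ht, map_zero, zero_add] at this
    subst ht0
    have hg : (g : V →ₗ[F] V) = LinearMap.id := b.ext fun i => by
      have := hfix (b i) (by simp)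
      rwa [ht, add_zero] at this
    refine Equiv.ext fun v => ?_
    rw [ht, add_zero]
    exact LinearMap.congr_fun hg v
  · rintro c ⟨B, rfl, hB⟩
    by_contra hlt
    obtain ⟨π, hπ, hfix, hne⟩ := LinearMap.exists_affine_isometry_fixing β halt hker B
      (by omega) (by omega)
    exact hne (hB π hπ hfix)

variable [Finite F]

theorem LinearMap.card_linearIndependent_gram_le (β : LinearMap.BilinForm F V)
    (hker : LinearMap.ker β = ⊥) (C : ℕ → ℕ → F) (k : ℕ) :
    Nat.card {w : Fin k → V // LinearIndependent F w ∧ ∀ i j, β (w i) (w j) = C i j} *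
      Nat.card F ^ (∑ i ∈ Finset.range k, i) ≤ Nat.card V ^ k := by
  induction k with
  | zero =>
    simp
  | succ k ih =>
    set q := Nat.card F
    have hq : 0 < q ^ k := pow_pos Nat.card_pos _
    set S := {w : Fin k → V // LinearIndependent F w ∧ ∀ i j, β (w i) (w j) = C i j}
    set T := {w : Fin (k + 1) → V // LinearIndependent F w ∧ ∀ i j, β (w i) (w j) = C i j}
    let f : T → S := fun w => ⟨fun i => w.1 i.castSucc,
      w.2.1.comp _ (Fin.castSucc_injective k), fun i j => by simpa using w.2.2 i.castSucc j.castSucc⟩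
    have hf : Nat.card T ≤ (Nat.card V / q ^ k) * Nat.card S := by
      refine Nat.card_le_mul_card_of_fiber_le f _ fun u => ?_
      rw [Nat.le_div_iff_mul_le hq]
      refine le_trans (Nat.mul_le_mul_right _ ?_)
        (LinearMap.card_prescribed_pairing_le β hker u.1 u.2.1 fun i => C i k)
      refine Nat.card_le_card_of_injective (fun w => ⟨w.1.1 (Fin.last k), fun i => ?_⟩) ?_
      · have h1 := w.1.2.2 i.castSucc (Fin.last k)
        have h2 : u.1 i = w.1.1 i.castSucc := (congrFun (congrArg Subtype.val w.2) i).symm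
        rw [h2, h1]
        simp
      · intro w w' h
        have h1 : w.1.1 (Fin.last k) = w'.1.1 (Fin.last k) := congrArg Subtype.val h
        have h2 : f w.1 = f w'.1 := w.2.trans w'.2.symm
        refine Subtype.ext (Subtype.ext (funext fun i => ?_))
        induction i using Fin.lastCases with
        | last => exact h1
        | cast i => exact congrFun (congrArg Subtype.val h2) i
    rw [Finset.sum_range_succ, pow_add, pow_succ]
    calc Nat.card T * (q ^ (∑ i ∈ Finset.range k, i) * q ^ k)
        ≤ (Nat.card V / q ^ k) * Nat.card S * (q ^ (∑ i ∈ Finset.range k, i) * q ^ k) :=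
          Nat.mul_le_mul_right _ hf
      _ = (Nat.card S * q ^ (∑ i ∈ Finset.range k, i)) * (Nat.card V / q ^ k * q ^ k) := by ring
      _ ≤ Nat.card V ^ k * Nat.card V := Nat.mul_le_mul ih (Nat.div_mul_le_self _ _)

theorem LinearMap.card_isometry_mul_le (β : LinearMap.BilinForm F V)
    (hker : LinearMap.ker β = ⊥) {d : ℕ} (b : Module.Basis (Fin d) F V) :
    Nat.card {g : V ≃ₗ[F] V // ∀ x y, β (g x) (g y) = β x y} *
      Nat.card F ^ (∑ i ∈ Finset.range d, i) ≤ Nat.card V ^ d := by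
  let C : ℕ → ℕ → F := fun i j =>
    if h : i < d ∧ j < d then β (b ⟨i, h.1⟩) (b ⟨j, h.2⟩) else 0
  refine le_trans (Nat.mul_le_mul_right _ ?_)
    (LinearMap.card_linearIndependent_gram_le β hker C d)
  refine Nat.card_le_card_of_injective
    (fun g => ⟨fun i => g.1 (b i), ?_, fun i j => ?_⟩) ?_
  · exact b.linearIndependent.map' (g.1 : V →ₗ[F] V) (LinearEquiv.ker g.1)
  · simp [C, g.2]
  · intro g g' h
    refine Subtype.ext (LinearEquiv.toLinearMap_injective (b.ext fun i => ?_))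
    exact congrFun (congrArg Subtype.val h) i

theorem LinearMap.card_linearEquiv_le_card_isometry_mul (β : LinearMap.BilinForm F V)
    (halt : ∀ x, β x x = 0) {d : ℕ} (b : Module.Basis (Fin d) F V) :
    Nat.card (V ≃ₗ[F] V) ≤ Nat.card {g : V ≃ₗ[F] V // ∀ x y, β (g x) (g y) = β x y} *
      Nat.card F ^ (∑ i ∈ Finset.range d, i) := by
  have hcard : Nat.card ((Σ i : Fin d, Fin i) → F) =
      Nat.card F ^ (∑ i ∈ Finset.range d, i) := by
    rw [Nat.card_fun, Nat.card_sigma, ← Fin.sum_univ_eq_sum_range (fun i => i)]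
    simp
  have hneg : ∀ x y, β x y = - β y x := fun x y => (LinearMap.IsAlt.neg (B := β) halt y x).symm
  rw [← hcard]
  refine Nat.card_le_mul_card_of_fiber_le
    (fun (g : V ≃ₗ[F] V) (p : Σ i : Fin d, Fin i) =>
      β (g (b p.1)) (g (b (Fin.castLE p.1.2.le p.2)))) _ fun c => ?_
  rcases isEmpty_or_nonempty {g : V ≃ₗ[F] V // (fun p : Σ i : Fin d, Fin i =>
      β (g (b p.1)) (g (b (Fin.castLE p.1.2.le p.2)))) = c} with h | ⟨⟨g₀, hg₀⟩⟩
  · simp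
  refine Nat.card_le_card_of_injective (fun g => ⟨g₀.symm.trans g.1, ?_⟩) ?_
  · have hlt : ∀ i j : Fin d, j < i → β (g.1 (b i)) (g.1 (b j)) = β (g₀ (b i)) (g₀ (b j)) :=
      fun i j hij => congrFun (g.2.trans hg₀.symm) ⟨i, ⟨j, hij⟩⟩
    have hall : ∀ i j : Fin d, β (g.1 (b i)) (g.1 (b j)) = β (g₀ (b i)) (g₀ (b j)) := by
      intro i j
      rcases lt_trichotomy i j with hij | rfl | hij
      · rw [hneg, hlt j i hij, ← hneg]
      · rw [halt, halt]
      · exact hlt i j hij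
    have hform : β.compl₁₂ (g.1 : V →ₗ[F] V) (g.1 : V →ₗ[F] V) =
        β.compl₁₂ (g₀ : V →ₗ[F] V) (g₀ : V →ₗ[F] V) :=
      LinearMap.ext_basis b b fun i j => hall i j
    intro x y
    have := LinearMap.congr_fun₂ hform (g₀.symm x) (g₀.symm y)
    simpa using this
  · intro g g' h
    refine Subtype.ext (LinearEquiv.ext fun x => ?_)
    have := LinearEquiv.congr_fun (congrArg Subtype.val h) (g₀ x)
    simpa using this

end Form

theorem Matrix.card_linearEquiv_pi (F : Type*) [Field F] [Fintype F] (d : ℕ) :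
    Nat.card ((Fin d → F) ≃ₗ[F] (Fin d → F)) =
      ∏ i : Fin d, (Fintype.card F ^ d - Fintype.card F ^ (i : ℕ)) := by
  rw [← Matrix.card_GL_field]
  exact (Nat.card_congr ((Matrix.GeneralLinearGroup.toLin.trans
    (LinearMap.GeneralLinearGroup.generalLinearEquiv F (Fin d → F))).toEquiv)).symm

theorem Nat.pow_mul_self_le_two_mul_prod_sub {q d : ℕ} (hq : 2 * d ≤ q) (hq0 : 0 < q) :
    q ^ (d * d) ≤ 2 * ∏ i : Fin d, (q ^ d - q ^ (i : ℕ)) := by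
  have hqR : (0 : ℝ) < q := by exact_mod_cast hq0
  have hdq : (d : ℝ) / q ≤ 1 / 2 := by
    rw [div_le_iff₀ hqR]
    have : (2 * d : ℝ) ≤ q := by exact_mod_cast hq
    linarith
  have hfac : ∀ i : Fin d, (q : ℝ) ^ d * (1 + -1 / q) ≤ ((q ^ d - q ^ (i : ℕ) : ℕ) : ℝ) := by
    intro i
    have hle : q ^ (i : ℕ) ≤ q ^ d := Nat.pow_le_pow_right hq0 i.2.le
    have hmul : (q : ℝ) * q ^ (i : ℕ) ≤ q ^ d := by
      rw [← _root_.pow_succ']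
      exact_mod_cast Nat.pow_le_pow_right hq0 i.2
    have hdiv : (q : ℝ) ^ (i : ℕ) ≤ q ^ d / q := by
      rw [le_div_iff₀ hqR]
      linarith
    push_cast [hle]
    calc (q : ℝ) ^ d * (1 + -1 / q) = q ^ d - q ^ d / q := by ring
      _ ≤ _ := by linarith
  have hd1 : d = 0 ∨ 1 ≤ d := by omega
  rcases hd1 with rfl | hd1
  · simp
  have hq1 : (1 : ℝ) ≤ q := by exact_mod_cast hq0
  have hinv : (1 : ℝ) / q ≤ 1 := by rw [div_le_iff₀ hqR]; linarith
  have hneg : (-1 : ℝ) / q = -(1 / q) := by ring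
  have hbern : 1 / 2 ≤ (1 + -1 / (q : ℝ)) ^ d := by
    have := one_add_mul_le_pow (a := -1 / (q : ℝ)) (by rw [hneg]; linarith) d
    have h2 : (d : ℝ) * (-1 / q) = -(d / q) := by ring
    rw [h2] at this
    linarith
  have hprod : ((q : ℝ) ^ d * (1 + -1 / q)) ^ d ≤
      ∏ i : Fin d, ((q ^ d - q ^ (i : ℕ) : ℕ) : ℝ) := by
    have := Finset.prod_le_prod (s := (Finset.univ : Finset (Fin d)))
      (f := fun _ => (q : ℝ) ^ d * (1 + -1 / q))
      (fun i _ => mul_nonneg (by positivity) (by rw [hneg]; linarith)) fun i _ => hfac i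
    simpa using this
  have : (q : ℝ) ^ (d * d) ≤ 2 * ∏ i : Fin d, ((q ^ d - q ^ (i : ℕ) : ℕ) : ℝ) := by
    calc (q : ℝ) ^ (d * d) = 2 * (q ^ (d * d) * (1 / 2)) := by ring
      _ ≤ 2 * (q ^ (d * d) * (1 + -1 / (q : ℝ)) ^ d) := by gcongr
      _ = 2 * ((q : ℝ) ^ d * (1 + -1 / q)) ^ d := by rw [mul_pow, pow_mul]
      _ ≤ _ := by gcongr
  exact_mod_cast this

theorem Real.round_two_mul_logb_div {q d N : ℕ} (hd : 0 < d) (hq : 16 ≤ q)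
    (hupper : N ^ 2 ≤ q ^ (d * (d + 3))) (hlower : q ^ (d * (d + 3)) ≤ 4 * N ^ 2) :
    round (2 * Real.logb 2 N / Real.logb 2 ((q : ℝ) ^ d)) = d + 3 := by
  have hq0 : (0 : ℝ) < q := by positivity
  have hN : (0 : ℝ) < N := by
    rcases Nat.eq_zero_or_pos N with rfl | h
    · have : 0 < q ^ (d * (d + 3)) := by positivity
      omega
    · exact_mod_cast h
  have hd1 : (1 : ℝ) ≤ d := by exact_mod_cast hd
  set L := Real.logb 2 q
  have hL : 4 ≤ L := by
    rw [Real.le_logb_iff_rpow_le (by norm_num) hq0]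
    norm_num
    exact_mod_cast hq
  have hup : 2 * Real.logb 2 N ≤ d * (d + 3) * L := by
    have : ((N : ℝ)) ^ 2 ≤ (q : ℝ) ^ (d * (d + 3)) := by exact_mod_cast hupper
    have := Real.logb_le_logb_of_le (b := 2) (by norm_num) (by positivity) this
    rw [Real.logb_pow, Real.logb_pow] at this
    push_cast at this
    exact this
  have hlo : d * (d + 3) * L ≤ 2 + 2 * Real.logb 2 N := by
    have : (q : ℝ) ^ (d * (d + 3)) ≤ 4 * (N : ℝ) ^ 2 := by exact_mod_cast hlower
    have := Real.logb_le_logb_of_le (b := 2) (by norm_num) (by positivity) this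
    have h4 : Real.logb 2 4 = 2 := by
      rw [Real.logb_eq_iff_rpow_eq] <;> norm_num
    rw [Real.logb_mul (by norm_num) (by positivity), Real.logb_pow, Real.logb_pow, h4] at this
    push_cast at this
    exact this
  have hdL : 4 ≤ d * L := by nlinarith
  rw [Real.logb_pow, round_eq, Int.floor_eq_iff]
  push_cast
  constructor
  · rw [← sub_le_iff_le_add, le_div_iff₀ (by linarith)]
    nlinarith
  · rw [← lt_sub_iff_add_lt, div_lt_iff₀ (by linarith)]
    nlinarith

/-- Fix an even integer `d ≥ 2`. There is a constant `Q` such that for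
every finite field `F` with `|F| ≥ Q`, for every nondegenerate alternating bilinear form
`β` on `V = F^d`, the affine symplectic group `G = {v ↦ g v + t : g ∈ Sp(V), t ∈ V}`
acting on `V` (of degree `n = |F|^d`) has minimal base size `round (2 log|G|/log n) − 2`. -/
theorem base_size_affine_symplectic_eq (d : ℕ) (hd : Even d) (hd2 : 2 ≤ d) :
    ∃ Q : ℕ, ∀ (F : Type) [Field F] [Fintype F], Q ≤ Fintype.card F →
      ∀ β : (Fin d → F) →ₗ[F] (Fin d → F) →ₗ[F] F,
        (∀ x, β x x = 0) →
        (∀ x, (∀ y, β x y = 0) → x = 0) →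
        ((sInf {c : ℕ | ∃ B : Finset (Fin d → F), B.card = c ∧
            ∀ π : Equiv.Perm (Fin d → F),
              (∃ g : (Fin d → F) ≃ₗ[F] (Fin d → F),
                (∀ x y, β (g x) (g y) = β x y) ∧ ∃ t, ∀ v, π v = g v + t) →
              (∀ v ∈ B, π v = v) → π = 1} : ℕ) : ℤ) =
          round (2 * Real.logb 2 (Nat.card {π : Equiv.Perm (Fin d → F) //
              ∃ g : (Fin d → F) ≃ₗ[F] (Fin d → F),
                (∀ x y, β (g x) (g y) = β x y) ∧ ∃ t, ∀ v, π v = g v + t}) /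
            Real.logb 2 ((Fintype.card F : ℝ) ^ d)) - 2 := by
  refine ⟨max 16 (2 * d), fun F _ _ hF β halt hnd => ?_⟩
  set q := Fintype.card F with hq
  have hq16 : 16 ≤ q := le_of_max_le_left hF
  have hqd : 2 * d ≤ q := le_of_max_le_right hF
  have hker : LinearMap.ker β = ⊥ :=
    LinearMap.ker_eq_bot'.2 fun x hx => hnd x fun y => by rw [hx, LinearMap.zero_apply]
  have hbase := LinearMap.sInf_card_base_affine_isometry β halt hker (by omega)
    (Pi.basisFun F (Fin d))
  have hup := LinearMap.card_isometry_mul_le β hker (Pi.basisFun F (Fin d))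
  have hlow := LinearMap.card_linearEquiv_le_card_isometry_mul β halt (Pi.basisFun F (Fin d))
  have hcard := LinearMap.card_affine_isometry β
  have hprod := Nat.pow_mul_self_le_two_mul_prod_sub hqd (by omega)
  have hV : Nat.card (Fin d → F) = q ^ d := by simp [hq]
  rw [Matrix.card_linearEquiv_pi, Nat.card_eq_fintype_card (α := F), ← hq] at hlow
  rw [hV, Nat.card_eq_fintype_card (α := F), ← hq] at hup
  rw [hV] at hcard
  set s := Nat.card {g : (Fin d → F) ≃ₗ[F] (Fin d → F) // ∀ x y, β (g x) (g y) = β x y}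
  set e := ∑ i ∈ Finset.range d, i with he
  have hee : e * 2 + d = d * d := by
    rw [he, Finset.sum_range_id_mul_two]
    obtain ⟨k, rfl⟩ : ∃ k, d = k + 1 := ⟨d - 1, by omega⟩
    rw [Nat.add_sub_cancel]
    ring
  have hlow' : q ^ (d * d) ≤ 2 * (s * q ^ e) := by omega
  have hpos : 0 < q ^ (e * 2) := by positivity
  have hN1 : (s * q ^ d) ^ 2 ≤ q ^ (d * (d + 3)) := by
    refine Nat.le_of_mul_le_mul_right ?_ hpos
    calc (s * q ^ d) ^ 2 * q ^ (e * 2) = (s * q ^ e) ^ 2 * q ^ (d * 2) := by ring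
      _ ≤ ((q ^ d) ^ d) ^ 2 * q ^ (d * 2) := by gcongr
      _ = q ^ (d * d + (d * d + d * 2)) := by ring
      _ = q ^ (d * d + 3 * d + e * 2) := by congr 1; omega
      _ = q ^ (d * (d + 3)) * q ^ (e * 2) := by ring
  have hN2 : q ^ (d * (d + 3)) ≤ 4 * (s * q ^ d) ^ 2 := by
    refine Nat.le_of_mul_le_mul_right ?_ hpos
    calc q ^ (d * (d + 3)) * q ^ (e * 2) = q ^ (d * d + 3 * d + e * 2) := by ring
      _ = q ^ (d * d + (d * d + d * 2)) := by congr 1; omega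
      _ = (q ^ (d * d)) ^ 2 * q ^ (d * 2) := by ring
      _ ≤ (2 * (s * q ^ e)) ^ 2 * q ^ (d * 2) := by gcongr
      _ = 4 * (s * q ^ d) ^ 2 * q ^ (e * 2) := by ring
  rw [hbase, hcard, Real.round_two_mul_logb_div (by omega) hq16 hN1 hN2]
  push_cast
  ring
end

section
/- Let m and k be integers with m ≥ 3, 1 ≤ k and 2k ≤ m, and set t = m/k (as a real number). Then (t/(ln t + 1))·(ln m − 1) < ln(m!) / ln C(m,k) < (t/ln t)·ln m. -/
/-- The lower bound `(n / k) ^ k ≤ C(n, k)`, without division. -/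
lemma Nat.pow_le_choose_mul_pow {n k : ℕ} (h : k ≤ n) : n ^ k ≤ n.choose k * k ^ k := by
  induction k generalizing n with
  | zero => simp
  | succ k ih =>
    obtain ⟨n, rfl⟩ : ∃ l, n = l + 1 := ⟨n - 1, by omega⟩
    have hkn : k ≤ n := by omega
    have hpow : (n + 1) ^ k ≤ n.choose k * (k + 1) ^ k := by
      rcases Nat.eq_zero_or_pos k with rfl | hk
      · simp
      refine Nat.le_of_mul_le_mul_right ?_ (Nat.pow_pos hk : 0 < k ^ k)
      calc (n + 1) ^ k * k ^ k = ((n + 1) * k) ^ k := (mul_pow _ _ _).symm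
        _ ≤ (n * (k + 1)) ^ k := Nat.pow_le_pow_left (by nlinarith) k
        _ = n ^ k * (k + 1) ^ k := mul_pow _ _ _
        _ ≤ (n.choose k * k ^ k) * (k + 1) ^ k := Nat.mul_le_mul_right _ (ih hkn)
        _ = n.choose k * (k + 1) ^ k * k ^ k := by ring
    calc (n + 1) ^ (k + 1) = (n + 1) * (n + 1) ^ k := by ring
      _ ≤ (n + 1) * (n.choose k * (k + 1) ^ k) := Nat.mul_le_mul_left _ hpow
      _ = (n + 1) * n.choose k * (k + 1) ^ k := by ring
      _ = (n + 1).choose (k + 1) * (k + 1) ^ (k + 1) := by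
        rw [Nat.add_one_mul_choose_eq]; ring

lemma Nat.mul_log_sub_one_lt_log_factorial {n : ℕ} (hn : n ≠ 0) :
    n * (Real.log n - 1) < Real.log n.factorial := by
  have hlog : 0 ≤ Real.log n := Real.log_natCast_nonneg n
  have hpi : 0 < Real.log (2 * Real.pi) := Real.log_pos (by linarith [Real.pi_gt_three])
  linarith [Stirling.le_log_factorial_stirling hn]

lemma Nat.log_factorial_lt_mul_log {n : ℕ} (hn : 2 ≤ n) :
    Real.log n.factorial < n * Real.log n := by
  rw [← Real.log_pow]
  refine Real.log_lt_log (mod_cast n.factorial_pos) ?_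
  exact_mod_cast n.descFactorial_self ▸ Nat.descFactorial_lt_pow (by omega : n ≠ 0) hn

lemma Nat.mul_log_div_le_log_choose {n k : ℕ} (hk : k ≠ 0) (h : k ≤ n) :
    k * Real.log ((n : ℝ) / k) ≤ Real.log (n.choose k) := by
  have hn : (0 : ℝ) < n := by exact_mod_cast (by omega : 0 < n)
  have hk' : (0 : ℝ) < k := by exact_mod_cast Nat.pos_of_ne_zero hk
  rw [← Real.log_pow]
  refine Real.log_le_log (by positivity) ?_
  rw [div_pow, div_le_iff₀ (by positivity)]
  exact_mod_cast Nat.pow_le_choose_mul_pow h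

lemma Nat.log_choose_lt_mul_log_div_add_one {n k : ℕ} (hk : k ≠ 0) (h : k ≤ n) :
    Real.log (n.choose k) < k * (Real.log ((n : ℝ) / k) + 1) := by
  have hn : (n : ℝ) ≠ 0 := by exact_mod_cast (by omega : n ≠ 0)
  have hk' : (k : ℝ) ≠ 0 := by exact_mod_cast hk
  have hchoose : (0 : ℝ) < n.choose k := mod_cast Nat.choose_pos h
  have hle := Real.log_le_log hchoose (Nat.choose_le_pow_div (α := ℝ) k n)
  rw [Real.log_div (pow_ne_zero _ hn) (mod_cast k.factorial_ne_zero), Real.log_pow] at hle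
  rw [Real.log_div hn hk']
  linarith [Nat.mul_log_sub_one_lt_log_factorial hk]

/-- For integers `m ≥ 3`, `1 ≤ k`, `2k ≤ m` and `t = m/k` (a real
number), we have `(t/(ln t + 1)) (ln m − 1) < ln(m!)/ln C(m,k) < (t/ln t) ln m`. -/
theorem log_factorial_div_log_choose_bounds (m k : ℕ) (hm : 3 ≤ m) (hk : 1 ≤ k)
    (hkm : 2 * k ≤ m) :
    ((m : ℝ) / k / (Real.log ((m : ℝ) / k) + 1)) * (Real.log m - 1) <
        Real.log (m.factorial) / Real.log (m.choose k) ∧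
      Real.log (m.factorial) / Real.log (m.choose k) <
        ((m : ℝ) / k / Real.log ((m : ℝ) / k)) * Real.log m := by
  have hk0 : (0 : ℝ) < k := by exact_mod_cast hk
  have hm3 : (3 : ℝ) ≤ m := by exact_mod_cast hm
  have hlogt : 0 < Real.log ((m : ℝ) / k) := by
    refine Real.log_pos ((one_lt_div hk0).2 ?_)
    exact_mod_cast (by omega : k < m)
  have hlogm : 1 < Real.log m := by
    rw [Real.lt_log_iff_exp_lt (by linarith)]
    linarith [Real.exp_one_lt_three]
  have hC_ge := Nat.mul_log_div_le_log_choose (n := m) (k := k) (by omega) (by omega)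
  have hC_lt := Nat.log_choose_lt_mul_log_div_add_one (n := m) (k := k) (by omega) (by omega)
  have hC : 0 < Real.log (m.choose k) := (mul_pos hk0 hlogt).trans_le hC_ge
  have hfact_gt := Nat.mul_log_sub_one_lt_log_factorial (n := m) (by omega)
  have hfact_lt := Nat.log_factorial_lt_mul_log (n := m) (by omega)
  rw [div_div, div_div, div_mul_eq_mul_div, div_mul_eq_mul_div]
  constructor
  · have hnum : 0 ≤ (m : ℝ) * (Real.log m - 1) := mul_nonneg (by linarith) (by linarith)
    exact div_lt_div₀ hfact_gt hC_lt.le (hnum.trans hfact_gt.le) hC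
  · have hnum : 0 ≤ (m : ℝ) * Real.log m := mul_nonneg (by linarith) (by linarith)
    exact div_lt_div₀ hfact_lt hC_ge hnum (mul_pos hk0 hlogt)
end

section
/- Let m and k be integers with m ≥ 5, 1 ≤ k, 2k ≤ m and k² ≤ m, and let b(m,k) denote the minimal base size of the symmetric group Sym(m) acting on the set Ω(m,k) of all k-element subsets of {1,…,m}. Then b(m,k) < 2·ln(m!) / ln C(m,k) + 4. -/
open Pointwise

/-- A family of finsets separates points if two points lying in the same members are equal. -/
def SeparatesPoints {ι α : Type*} (S : ι → Finset α) : Prop :=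
  ∀ p q, (∀ i, p ∈ S i ↔ q ∈ S i) → p = q

namespace SeparatesPoints

variable {ι α : Type*} [DecidableEq ι] [Fintype α] [DecidableEq α] {S : ι → Finset α}

/-- A member of a separating family containing fewer than half of the points can be enlarged by
one point without losing separation. -/
theorem exists_insert (hS : SeparatesPoints S) (i : ι) (hi : 2 * (S i).card < Fintype.card α) :
    ∃ x ∉ S i, SeparatesPoints (Function.update S i (insert x (S i))) := by
  by_contra! hcon
  have conflict : ∀ x, ∃ y, x ∉ S i → y ∈ S i ∧ ∀ j ≠ i, (x ∈ S j ↔ y ∈ S j) := by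
    intro x
    by_cases hx : x ∈ S i
    · exact ⟨x, fun h => absurd hx h⟩
    have h := hcon x hx
    unfold SeparatesPoints at h
    push Not at h
    obtain ⟨p, q, hpq, hne⟩ := h
    have hpqi := hpq i
    simp only [Function.update_self, Finset.mem_insert] at hpqi
    have hpqj : ∀ j ≠ i, (p ∈ S j ↔ q ∈ S j) := fun j hj => by
      simpa [Function.update_of_ne hj] using hpq j
    by_cases hp : p = x
    · subst hp
      exact ⟨q, fun _ => ⟨by grind, hpqj⟩⟩
    by_cases hq : q = x
    · subst hq
      exact ⟨p, fun _ => ⟨by grind, fun j hj => (hpqj j hj).symm⟩⟩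
    refine absurd (hS p q fun j => ?_) hne
    by_cases hj : j = i
    · subst hj
      grind
    · exact hpqj j hj
  choose f hf using conflict
  have hle : (S i)ᶜ.card ≤ (S i).card := by
    refine Finset.card_le_card_of_injOn f (fun x hx => (hf x (by simpa using hx)).1) ?_
    intro x hx y hy hxy
    simp only [Finset.coe_compl, Set.mem_compl_iff, Finset.mem_coe] at hx hy
    refine hS x y fun j => ?_
    by_cases hj : j = i
    · subst hj
      exact iff_of_false hx hy
    · rw [(hf x hx).2 j hj, (hf y hy).2 j hj, hxy]
  rw [Finset.card_compl] at hle
  omega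

/-- A separating family of sets of size at most `k` can be padded to sets of size exactly `k`. -/
theorem exists_card_eq [Fintype ι] {k : ℕ} (hk : 2 * k ≤ Fintype.card α)
    (hS : SeparatesPoints S) (hcard : ∀ i, (S i).card ≤ k) :
    ∃ T : ι → Finset α, SeparatesPoints T ∧ ∀ i, (T i).card = k := by
  induction hn : ∑ i, (k - (S i).card) using Nat.strong_induction_on generalizing S with
  | _ n ih =>
    by_cases hall : ∀ i, (S i).card = k
    · exact ⟨S, hS, hall⟩
    push Not at hall
    obtain ⟨i, hi⟩ := hall
    have hlt : (S i).card < k := lt_of_le_of_ne (hcard i) hi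
    obtain ⟨x, hx, hsep⟩ := hS.exists_insert i (by omega)
    refine ih _ ?_ hsep ?_ rfl
    · rw [← hn]
      refine Finset.sum_lt_sum (fun j _ => ?_) ⟨i, Finset.mem_univ i, ?_⟩
      · by_cases hj : j = i
        · subst hj
          simp only [Function.update_self, Finset.card_insert_of_notMem hx]
          omega
        · simp [Function.update_of_ne hj]
      · simp only [Function.update_self, Finset.card_insert_of_notMem hx]
        omega
    · intro j
      by_cases hj : j = i
      · subst hj
        simp only [Function.update_self, Finset.card_insert_of_notMem hx]
        omega
      · simpa [Function.update_of_ne hj] using hcard j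

end SeparatesPoints

/-- The points `p` with `p ≡ x (mod c)` and `p / c < k`. -/
def columnBlock (m k c x : ℕ) : Finset (Fin m) :=
  {p | p.val % c = x ∧ p.val / c < k}

/-- The points `p` with `1 ≤ p / c ≤ k` and `p + p / c ≡ y (mod c)`. -/
def diagonalBlock (m k c y : ℕ) : Finset (Fin m) :=
  {p | (p.val + p.val / c) % c = y ∧ 1 ≤ p.val / c ∧ p.val / c ≤ k}

theorem card_columnBlock_le (m k c x : ℕ) : (columnBlock m k c x).card ≤ k := by
  rw [← Finset.card_range k]
  refine Finset.card_le_card_of_injOn (fun p => p.val / c) (fun p hp => ?_) ?_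
  · simp_all [columnBlock]
  · intro p hp q hq hpq
    simp only [columnBlock, Finset.coe_filter, Finset.mem_univ, true_and, Set.mem_ofPred_eq]
      at hp hq hpq
    rw [Fin.ext_iff, ← Nat.div_add_mod p.val c, ← Nat.div_add_mod q.val c, hpq, hp.1, hq.1]

theorem card_diagonalBlock_le (m k c y : ℕ) : (diagonalBlock m k c y).card ≤ k := by
  have hk : (Finset.Icc 1 k).card = k := by simp
  rw [← hk]
  refine Finset.card_le_card_of_injOn (fun p => p.val / c) (fun p hp => ?_) ?_
  · simp_all [diagonalBlock]
  · intro p hp q hq hpq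
    simp only [diagonalBlock, Finset.coe_filter, Finset.mem_univ, true_and, Set.mem_ofPred_eq]
      at hp hq hpq
    have hmod : p.val ≡ q.val [MOD c] := by
      have h : (p.val + p.val / c) % c = (q.val + q.val / c) % c := hp.1.trans hq.1.symm
      rw [hpq] at h
      exact Nat.ModEq.add_right_cancel' _ h
    rw [Fin.ext_iff, ← Nat.div_add_mod p.val c, ← Nat.div_add_mod q.val c, hpq, hmod]

theorem separatesPoints_blocks {m k c : ℕ} (hk : 1 ≤ k) (hc : 0 < c) (hkc : k ≤ c + 1)
    (hm : m ≤ c * (k + 1) + 1) :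
    SeparatesPoints (Sum.elim (fun x : Fin c => columnBlock m k c x)
      (fun y : Fin c => diagonalBlock m k c y)) := by
  intro p q h
  have hcol : ∀ x < c, ((p.val % c = x ∧ p.val / c < k) ↔ (q.val % c = x ∧ q.val / c < k)) :=
    fun x hx => by simpa [columnBlock] using h (Sum.inl ⟨x, hx⟩)
  have hdiag : ∀ y < c, (((p.val + p.val / c) % c = y ∧ 1 ≤ p.val / c ∧ p.val / c ≤ k) ↔
      ((q.val + q.val / c) % c = y ∧ 1 ≤ q.val / c ∧ q.val / c ≤ k)) :=
    fun y hy => by simpa [diagonalBlock] using h (Sum.inr ⟨y, hy⟩)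
  have hcp := hcol _ (Nat.mod_lt p.val hc)
  have hcq := hcol _ (Nat.mod_lt q.val hc)
  have hdp := hdiag _ (Nat.mod_lt (p.val + p.val / c) hc)
  have hdq := hdiag _ (Nat.mod_lt (q.val + q.val / c) hc)
  have last : ∀ r : Fin m, k < r.val / c → r.val = c * (k + 1) := fun r hr => by
    have h₁ : c * (k + 1) ≤ c * (r.val / c) := Nat.mul_le_mul_left c hr
    have h₂ := Nat.mul_div_le r.val c
    have h₃ := r.isLt
    omega
  have hp := Nat.div_add_mod p.val c
  have hq := Nat.div_add_mod q.val c
  have of_row_eq : p.val / c = q.val / c → p.val % c = q.val % c → p = q := fun h₁ h₂ => by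
    rw [Fin.ext_iff, ← hp, ← hq, h₁, h₂]
  have of_diag_eq : p.val / c = q.val / c → (p.val + p.val / c) % c = (q.val + q.val / c) % c →
      p = q := fun h₁ h₂ => by
    refine of_row_eq h₁ ?_
    rw [h₁] at h₂
    exact Nat.ModEq.add_right_cancel' _ h₂
  have of_both : p.val / c < k → 1 ≤ p.val / c → q.val / c < k → 1 ≤ q.val / c →
      p.val % c = q.val % c → (p.val + p.val / c) % c = (q.val + q.val / c) % c → p = q := by
    intro h₁ h₂ h₃ h₄ h₅ h₆
    have hmod : p.val / c ≡ q.val / c [MOD c] := Nat.ModEq.add_left_cancel h₅ h₆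
    refine of_row_eq ?_ h₅
    have hmod' : p.val / c - 1 ≡ q.val / c - 1 [MOD c] := by
      refine Nat.ModEq.add_right_cancel' 1 ?_
      rwa [Nat.sub_add_cancel h₂, Nat.sub_add_cancel h₄]
    have := hmod'.eq_of_lt_of_lt (by omega) (by omega)
    omega
  have lastp := last p
  have lastq := last q
  generalize p.val / c = dp at *
  generalize q.val / c = dq at *
  generalize (p.val + dp) % c = yp at *
  generalize (q.val + dq) % c = yq at *
  generalize p.val % c = xp at *
  generalize q.val % c = xq at *
  rw [Fin.ext_iff] at *
  clear h hcol hdiag last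
  by_cases h₁ : dp < k <;> by_cases h₂ : 1 ≤ dp <;> by_cases h₃ : dq < k <;>
    by_cases h₄ : 1 ≤ dq <;> grind

/-- `Sym(m)` acting on `k`-subsets has a base of size at most `2c` when
`k - 1 ≤ c` and `m ≤ c (k + 1) + 1`. -/
theorem exists_base_card_le {m k c : ℕ} (hk : 1 ≤ k) (hkm : 2 * k ≤ m) (hc : 0 < c)
    (hkc : k ≤ c + 1) (hm : m ≤ c * (k + 1) + 1) :
    ∃ B : Finset (Finset (Fin m)), B.card ≤ 2 * c ∧ (∀ s ∈ B, s.card = k) ∧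
      ∀ g : Equiv.Perm (Fin m), (∀ s ∈ B, g • s = s) → g = 1 := by
  obtain ⟨T, hT, hcard⟩ := (separatesPoints_blocks hk hc hkc hm).exists_card_eq (k := k)
    (by simpa using hkm)
    (by rintro (x | y) <;> simp [card_columnBlock_le, card_diagonalBlock_le])
  refine ⟨Finset.univ.image T, ?_, Finset.forall_mem_image.mpr fun i _ => hcard i, fun g hg => ?_⟩
  · refine Finset.card_image_le.trans ?_
    simp [two_mul]
  · ext1 p
    refine hT _ _ fun i => ?_
    have hi := hg (T i) (by simp)
    have hmem := Finset.smul_mem_smul_finset_iff (s := T i) (b := p) g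
    rw [hi] at hmem
    exact hmem

theorem mul_log_sub_le_log_factorial {m : ℕ} (hm : 1 ≤ m) :
    m * (Real.log m - 1) ≤ Real.log m.factorial := by
  have hm0 : (0 : ℝ) < m := by exact_mod_cast hm
  have hf : (0 : ℝ) < m.factorial := by exact_mod_cast m.factorial_pos
  have h := Real.log_le_log (by positivity) (Real.pow_div_factorial_le_exp (m : ℝ) hm0.le m)
  rw [Real.log_exp, Real.log_div (by positivity) hf.ne', Real.log_pow] at h
  linarith

theorem log_choose_le {m k : ℕ} (hkm : k ≤ m) (hm : 1 ≤ m) :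
    Real.log (m.choose k) ≤ k * Real.log m - Real.log k.factorial := by
  have hm0 : (0 : ℝ) < m := by exact_mod_cast hm
  have hf : (0 : ℝ) < k.factorial := by exact_mod_cast k.factorial_pos
  have hch : (0 : ℝ) < m.choose k := by exact_mod_cast Nat.choose_pos hkm
  have h := Real.log_le_log hch (Nat.choose_le_pow_div (α := ℝ) k m)
  rwa [Real.log_div (by positivity) hf.ne', Real.log_pow] at h

theorem add_one_lt_two_log_add_log_factorial {k : ℕ} (hk : 4 ≤ k) :
    (k : ℝ) + 1 < 2 * Real.log k + Real.log k.factorial := by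
  have hlog2 := Real.log_two_gt_d9
  induction k, hk using Nat.le_induction with
  | base =>
    have h₁ : Real.log ((4 : ℕ) : ℝ) = 2 * Real.log 2 := by
      rw [show ((4 : ℕ) : ℝ) = 2 ^ 2 by norm_num, Real.log_pow]; norm_num
    have h₂ : 4 * Real.log 2 ≤ Real.log ((Nat.factorial 4 : ℕ) : ℝ) := by
      rw [← Nat.cast_ofNat (n := 4), ← Real.log_pow]
      exact Real.log_le_log (by norm_num) (by norm_num [Nat.factorial])
    rw [h₁]
    push_cast
    linarith
  | succ k hk ih =>
    have hk0 : (4 : ℝ) ≤ k := by exact_mod_cast hk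
    have h₁ : Real.log k ≤ Real.log ((k + 1 : ℕ) : ℝ) :=
      Real.log_le_log (by linarith) (by push_cast; linarith)
    have h₂ : 2 * Real.log 2 ≤ Real.log ((k + 1 : ℕ) : ℝ) := by
      rw [← Nat.cast_ofNat (n := 2), ← Real.log_pow]
      exact Real.log_le_log (by norm_num) (by push_cast; linarith)
    rw [Nat.factorial_succ, Nat.cast_mul, Real.log_mul (by positivity) (by positivity)]
    push_cast at *
    linarith

theorem log_inequality {m k : ℕ} (hm : 5 ≤ m) (hk : 1 ≤ k) (hk2 : k ^ 2 ≤ m) (hkm : k + 3 ≤ m) :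
    ((m : ℝ) - k - 3) * (k * Real.log m - Real.log k.factorial) <
      (k + 1) * (m * (Real.log m - 1)) := by
  have hm0 : (5 : ℝ) ≤ m := by exact_mod_cast hm
  have hlog2 := Real.log_two_gt_d9
  have pow_le : ∀ n : ℕ, 2 ^ n ≤ m → n * Real.log 2 ≤ Real.log m := fun n hn => by
    rw [← Real.log_pow]
    exact Real.log_le_log (by positivity) (by exact_mod_cast hn)
  have h4 := pow_le 2 (by omega)
  push_cast at h4
  rcases lt_or_ge k 4 with hk4 | hk4
  · interval_cases k
    · simp only [Nat.factorial_one, Nat.cast_one, Real.log_one]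
      rcases lt_or_ge m 8 with h | h
      · have hm8 : (m : ℝ) < 8 := by exact_mod_cast h
        nlinarith
      · have h8 := pow_le 3 h
        push_cast at h8
        nlinarith
    · simp only [Nat.factorial_two, Nat.cast_ofNat]
      rcases lt_or_ge m 8 with h | h
      · have hm8 : (m : ℝ) < 8 := by exact_mod_cast h
        nlinarith
      · have h8 := pow_le 3 h
        push_cast at h8
        rcases lt_or_ge m 16 with h' | h'
        · have hm16 : (m : ℝ) < 16 := by exact_mod_cast h'
          nlinarith
        · have h16 := pow_le 4 h'
          push_cast at h16
          nlinarith
    · have h8 := pow_le 3 (by omega)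
      have hm9 : (9 : ℝ) ≤ m := by exact_mod_cast hk2
      have h6 : 5 * Real.log 2 ≤ 2 * Real.log ((Nat.factorial 3 : ℕ) : ℝ) := by
        rw [← Nat.cast_ofNat (n := 5), ← Nat.cast_ofNat (n := 2), ← Real.log_pow, ← Real.log_pow]
        exact Real.log_le_log (by norm_num) (by norm_num [Nat.factorial])
      push_cast at h8 h6 ⊢
      rcases lt_or_ge m 16 with h' | h'
      · have hm16 : (m : ℝ) < 16 := by exact_mod_cast h'
        nlinarith
      · have h16 := pow_le 4 h'
        push_cast at h16
        nlinarith
  · have hk0 : (4 : ℝ) ≤ k := by exact_mod_cast hk4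
    have hlogk : 2 * Real.log k ≤ Real.log m := by
      rw [← Nat.cast_ofNat (n := 2), ← Real.log_pow]
      exact Real.log_le_log (by positivity) (by exact_mod_cast hk2)
    have hfact : Real.log k.factorial ≤ k * Real.log m := by
      rw [← Real.log_pow]
      refine Real.log_le_log (by positivity) ?_
      have : k ≤ m := by omega
      exact_mod_cast k.factorial_le_pow.trans (Nat.pow_le_pow_left this k)
    have hmain := add_one_lt_two_log_add_log_factorial hk4
    have h₁ : 0 < (m : ℝ) * (Real.log m + Real.log k.factorial - (k + 1)) :=
      mul_pos (by linarith) (by linarith)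
    have h₂ : 0 ≤ ((k : ℝ) + 3) * (k * Real.log m - Real.log k.factorial) :=
      mul_nonneg (by linarith) (by linarith)
    linarith

theorem sub_mul_log_choose_lt {m k : ℕ} (hm : 5 ≤ m) (hk : 1 ≤ k) (hkm : k ≤ m)
    (hk2 : k ^ 2 ≤ m) :
    ((m : ℝ) - k - 3) * Real.log (m.choose k) < (k + 1) * Real.log m.factorial := by
  rcases le_or_gt (k + 3) m with h | h
  · have h' : (0 : ℝ) ≤ (m : ℝ) - k - 3 := by
      have : ((k + 3 : ℕ) : ℝ) ≤ m := by exact_mod_cast h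
      push_cast at this
      linarith
    calc _ ≤ ((m : ℝ) - k - 3) * (k * Real.log m - Real.log k.factorial) :=
          mul_le_mul_of_nonneg_left (log_choose_le hkm (by omega)) h'
      _ < (k + 1) * (m * (Real.log m - 1)) := log_inequality hm hk hk2 h
      _ ≤ _ := mul_le_mul_of_nonneg_left (mul_log_sub_le_log_factorial (by omega))
          (by positivity)
  · have h' : (m : ℝ) - k - 3 ≤ 0 := by
      have : (m : ℝ) ≤ ((k + 3 : ℕ) : ℝ) := by exact_mod_cast h.le
      push_cast at this
      linarith
    have hfact : 0 < Real.log m.factorial := by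
      refine Real.log_pos ?_
      have := Nat.self_le_factorial m
      exact_mod_cast (by omega : 1 < m.factorial)
    exact (mul_nonpos_of_nonpos_of_nonneg h' (Real.log_natCast_nonneg _)).trans_lt (by positivity)

/-- For integers `m ≥ 5`, `1 ≤ k`, `2k ≤ m` with `k² ≤ m`, the minimal
base size `b(m,k)` of `Sym(m)` acting on `k`-element subsets of `{1,…,m}` satisfies
`b(m,k) < 2 ln(m!)/ln C(m,k) + 4`. -/
theorem base_size_subsets_small_k (m k : ℕ) (hm : 5 ≤ m) (hk : 1 ≤ k)
    (hkm : 2 * k ≤ m) (hk2 : k ^ 2 ≤ m) :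
    ((sInf {c : ℕ | ∃ B : Finset (Finset (Fin m)), B.card = c ∧
        (∀ s ∈ B, s.card = k) ∧
        ∀ g : Equiv.Perm (Fin m), (∀ s ∈ B, g • s = s) → g = 1} : ℕ) : ℝ) <
      2 * (Real.log (m.factorial) / Real.log (m.choose k)) + 4 := by
  set c := (m - 1 + k) / (k + 1) with hc
  have hcmul : c * (k + 1) ≤ m - 1 + k := Nat.div_mul_le_self _ _
  have hmc : m ≤ c * (k + 1) + 1 := by
    have := Nat.lt_div_mul_add (a := m - 1 + k) (b := k + 1) (by omega)
    rw [← hc] at this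
    omega
  have hc0 : 0 < c := Nat.div_pos (by omega) (by omega)
  have hkc : k ≤ c + 1 := by
    by_contra! h
    nlinarith
  obtain ⟨B, hBcard, hB, hbase⟩ := exists_base_card_le hk hkm hc0 hkc hmc
  have hle := (Nat.sInf_le (s := {c : ℕ | ∃ B : Finset (Finset (Fin m)), B.card = c ∧
        (∀ s ∈ B, s.card = k) ∧
        ∀ g : Equiv.Perm (Fin m), (∀ s ∈ B, g • s = s) → g = 1}) ⟨B, rfl, hB, hbase⟩).trans hBcard
  refine (Nat.cast_le.mpr hle).trans_lt ?_
  have hlog : 0 < Real.log (m.choose k) := by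
    refine Real.log_pos ?_
    have h₁ : 1 < m.choose k := by
      rw [Nat.choose_eq_choose_pred_add (by omega) (by omega)]
      have h₂ : 0 < (m - 1).choose (k - 1) := Nat.choose_pos (by omega)
      have h₃ : 0 < (m - 1).choose k := Nat.choose_pos (by omega)
      omega
    exact_mod_cast h₁
  have hcR : (c : ℝ) * (k + 1) ≤ m - 1 + k := by
    have : ((c * (k + 1) : ℕ) : ℝ) ≤ ((m - 1 + k : ℕ) : ℝ) := by exact_mod_cast hcmul
    push_cast [Nat.cast_sub (show 1 ≤ m by omega)] at this
    exact this
  have hmain := sub_mul_log_choose_lt hm hk (by omega) hk2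
  have hk0 : (0 : ℝ) < k + 1 := by positivity
  have hdiv : ((m : ℝ) - k - 3) / (k + 1) < Real.log m.factorial / Real.log (m.choose k) := by
    rw [div_lt_div_iff₀ hk0 hlog]
    linarith
  have hc' : (c : ℝ) - 2 ≤ ((m : ℝ) - k - 3) / (k + 1) := by
    rw [le_div_iff₀ hk0]
    linarith
  push_cast
  linarith
end

section
/- Let a and b be integers with 2 ≤ a < b. Then ln(b)/ln(a) − 1 < ln((ab)!) / ln( (ab)! / ((b!)^a · a!) ). -/
open Nat in
theorem factorial_mul_le_pow_mul_factorial_pow (a b : ℕ) :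
    (a * b)! ≤ a ^ (a * b) * b ! ^ a := by
  induction a with
  | zero => simp
  | succ a ih =>
    have hc : (a * b + b).choose (a * b) * (a * b)! * b ! = (a * b + b)! := by
      simpa using Nat.choose_mul_factorial_mul_factorial (Nat.le_add_right (a * b) b)
    have hp : a ^ (a * b) * (a * b + b).choose (a * b) ≤ (a + 1) ^ (a * b + b) := by
      rw [add_pow]
      simpa using Finset.single_le_sum
        (f := fun m => a ^ m * 1 ^ (a * b + b - m) * (a * b + b).choose m)
        (fun _ _ => Nat.zero_le _)
        (Finset.mem_range.2 (by omega : a * b < a * b + b + 1))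
    calc ((a + 1) * b)! = (a * b + b).choose (a * b) * (a * b)! * b ! := by
          rw [hc, Nat.succ_mul]
      _ ≤ (a * b + b).choose (a * b) * (a ^ (a * b) * b ! ^ a) * b ! := by gcongr
      _ = (a ^ (a * b) * (a * b + b).choose (a * b)) * b ! ^ (a + 1) := by ring
      _ ≤ (a + 1) ^ (a * b + b) * b ! ^ (a + 1) := by gcongr
      _ = (a + 1) ^ ((a + 1) * b) * b ! ^ (a + 1) := by rw [Nat.succ_mul]

theorem Nat.one_lt_uniformBell {m n : ℕ} (hm : 2 ≤ m) (hn : 2 ≤ n) :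
    1 < Nat.uniformBell m n := by
  rw [Nat.uniformBell_eq]
  have hpos : ∀ p, 0 < (p * n + n - 1).choose (n - 1) := fun p =>
    Nat.choose_pos (by have := Nat.zero_le (p * n); omega)
  have h1 : 1 < (1 * n + n - 1).choose (n - 1) := by
    have := Nat.choose_le_choose (n - 1) (by omega : n ≤ 1 * n + n - 1)
    have h : n.choose (n - 1) = n := by
      rw [Nat.choose_symm (by omega : 1 ≤ n), Nat.choose_one_right]
    omega
  exact h1.trans_le (Finset.single_le_prod' (f := fun p => (p * n + n - 1).choose (n - 1))
    (fun p _ => hpos p) (Finset.mem_range.2 (by omega)))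

theorem mul_log_sub_le_log_factorial_s9 {n : ℕ} (hn : 0 < n) :
    (n : ℝ) * Real.log n - n ≤ Real.log n.factorial := by
  have hn' : (0 : ℝ) < n := by exact_mod_cast hn
  have hf : (0 : ℝ) < n.factorial := by exact_mod_cast n.factorial_pos
  have h := Real.log_le_log (by positivity) (Real.pow_div_factorial_le_exp (n : ℝ) hn'.le n)
  rw [Real.log_div (by positivity) hf.ne', Real.log_pow, Real.log_exp] at h
  linarith

/-- For integers `2 ≤ a < b`,
`ln b / ln a − 1 < ln((ab)!) / ln((ab)!/((b!)^a a!))`. -/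
theorem log_partition_count_bound (a b : ℕ) (ha : 2 ≤ a) (hab : a < b) :
    Real.log b / Real.log a - 1 <
      Real.log ((a * b).factorial) /
        Real.log (((a * b).factorial : ℝ) / ((b.factorial : ℝ) ^ a * a.factorial)) := by
  have ha0 : (0 : ℝ) < a := by exact_mod_cast (by omega : 0 < a)
  have hb0 : (0 : ℝ) < b := by exact_mod_cast (by omega : 0 < b)
  have haf : (1 : ℝ) ≤ a.factorial := by exact_mod_cast a.factorial_pos
  have hbf : (0 : ℝ) < b.factorial := by exact_mod_cast b.factorial_pos
  have hnf : (0 : ℝ) < (a * b).factorial := by exact_mod_cast (a * b).factorial_pos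
  have hla : 1 / 2 < Real.log a := by
    have := Real.log_le_log two_pos (by exact_mod_cast ha : (2 : ℝ) ≤ a)
    linarith [Real.log_two_gt_d9]
  have hlab : Real.log a < Real.log b := Real.log_lt_log ha0 (by exact_mod_cast hab)
  have hD : 0 < Real.log (((a * b).factorial : ℝ) / ((b.factorial : ℝ) ^ a * a.factorial)) := by
    apply Real.log_pos
    have h1 : (1 : ℝ) < Nat.uniformBell a b := by
      exact_mod_cast Nat.one_lt_uniformBell ha (by omega : 2 ≤ b)
    have h2 : (Nat.uniformBell a b : ℝ) * b.factorial ^ a * a.factorial = (a * b).factorial := by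
      exact_mod_cast Nat.uniformBell_mul_eq a (by omega : b ≠ 0)
    rw [lt_div_iff₀ (by positivity), ← h2, mul_assoc]
    gcongr
  have hDle : Real.log (((a * b).factorial : ℝ) / ((b.factorial : ℝ) ^ a * a.factorial)) ≤
      (a * b : ℝ) * Real.log a := by
    rw [← Nat.cast_mul, ← Real.log_pow]
    apply Real.log_le_log (by positivity)
    rw [div_le_iff₀ (by positivity)]
    calc ((a * b).factorial : ℝ) ≤ (a : ℝ) ^ (a * b) * (b.factorial : ℝ) ^ a := by
          exact_mod_cast factorial_mul_le_pow_mul_factorial_pow a b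
      _ ≤ (a : ℝ) ^ (a * b) * ((b.factorial : ℝ) ^ a * a.factorial) := by
          gcongr
          exact le_mul_of_one_le_right (by positivity) haf
  have hN := mul_log_sub_le_log_factorial_s9 (n := a * b) (Nat.mul_pos (by omega) (by omega))
  rw [Nat.cast_mul, Real.log_mul ha0.ne' hb0.ne'] at hN
  rw [lt_div_iff₀ hD, div_sub_one (by positivity), div_mul_eq_mul_div, div_lt_iff₀ (by positivity)]
  calc _ ≤ (Real.log b - Real.log a) * ((a * b : ℝ) * Real.log a) := by
        gcongr
    _ < (a * b * (Real.log a + Real.log b) - a * b) * Real.log a := by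
        have : 0 < (a * b : ℝ) * Real.log a * (2 * Real.log a - 1) :=
          mul_pos (by positivity) (by linarith)
        linarith
    _ ≤ _ := by gcongr
end

section
/- Let F be a finite field, let d and k be integers with 1 ≤ k and 2k ≤ d, and let V = F^d. Then there exist k-dimensional subspaces W₁, …, W_s of V with s ≤ d/k + 5 such that every g ∈ GL(V) satisfying g(W_i) = W_i for all i = 1,…,s is a scalar transformation (i.e. g = λ·id_V for some λ ∈ F). -/
open Fin.CommRing in
/-- The cyclic shift and the projection to the zeroth coordinate have only scalars as common
centralizer. -/
theorem exists_smul_of_comm_cyclic_shift_of_comm_proj {F : Type*} [Field F] (k : ℕ) [NeZero k]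
    (A : (Fin k → F) →ₗ[F] (Fin k → F))
    (hshift : ∀ u, A (LinearMap.funLeft F F (fun i : Fin k => i - 1) u) =
      LinearMap.funLeft F F (fun i : Fin k => i - 1) (A u))
    (hproj : ∀ u, A (LinearMap.single F (fun _ : Fin k => F) 0 (u 0)) =
      LinearMap.single F (fun _ : Fin k => F) 0 (A u 0)) :
    ∃ c : F, ∀ u, A u = c • u := by
  set c : F := A (Pi.single 0 1) 0
  have hnat : ∀ n : ℕ, A (Pi.single (n : Fin k) 1) = c • Pi.single (n : Fin k) 1 := by
    intro n
    induction n with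
    | zero =>
      have h := hproj (Pi.single 0 1)
      simp only [Pi.single_eq_same, LinearMap.coe_single] at h
      rw [Nat.cast_zero, h]
      ext j
      by_cases hj : j = 0
      · subst hj; simp [c]
      · simp [hj]
    | succ n ih =>
      have hs : (Pi.single ((n + 1 : ℕ) : Fin k) 1 : Fin k → F) =
          LinearMap.funLeft F F (fun i : Fin k => i - 1) (Pi.single (n : Fin k) 1) := by
        ext j
        simp only [LinearMap.funLeft_apply, Pi.single_apply, Nat.cast_succ, sub_eq_iff_eq_add]
      rw [hs, hshift, ih, map_smul]
  refine ⟨c, fun u => ?_⟩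
  suffices h : A = c • LinearMap.id by simp [h]
  refine LinearMap.pi_ext' fun i => LinearMap.ext_ring ?_
  simpa using hnat i

/-- If `U` has two endomorphisms whose common centralizer is scalar, and `R` is a retract of `U`,
then `U ^ m × R` has `m + 5` embedded copies of `U` whose common stabilizer is scalar. -/
theorem exists_embeddings_forall_invariant_imp_scalar {F U R ι : Type*} [Field F]
    [AddCommGroup U] [Module F U] [AddCommGroup R] [Module F R] [Fintype ι] [DecidableEq ι]
    (a b : ι) (hab : a ≠ b) (B C : U →ₗ[F] U)
    (hBC : ∀ A : U →ₗ[F] U, (∀ u, A (B u) = B (A u)) → (∀ u, A (C u) = C (A u)) →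
      ∃ c : F, ∀ u, A u = c • u)
    (p : U →ₗ[F] R) (s : R →ₗ[F] U) (hps : ∀ x, p (s x) = x) :
    ∃ f : ι ⊕ Fin 5 → (U →ₗ[F] (ι → U) × R),
      (∀ i, Function.Injective (f i)) ∧
      ∀ g : ((ι → U) × R) →ₗ[F] ((ι → U) × R),
        (∀ i u, ∃ v, g (f i u) = f i v) → ∃ c : F, ∀ x, g x = c • x := by
  let E (i : ι) : U →ₗ[F] (ι → U) := LinearMap.single F (fun _ => U) i
  let T : Fin 5 → (U →ₗ[F] (ι → U) × R) :=
    ![(LinearMap.pi fun _ => LinearMap.id).prod 0,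
      (E a + E b ∘ₗ B).prod 0,
      (E a + E b ∘ₗ C).prod 0,
      (E a ∘ₗ (LinearMap.id - s ∘ₗ p)).prod p,
      (E b).prod p]
  have hE (i j : ι) (u : U) : E i u j = if j = i then u else 0 := by
    simp [E, Pi.single_apply]
  refine ⟨Sum.elim (fun i => (E i).prod 0) T, ?_, ?_⟩
  · rintro (i | i)
    · refine (injective_iff_map_eq_zero _).2 fun u hu => ?_
      simpa [hE] using congrFun (congrArg Prod.fst hu) i
    · refine (injective_iff_map_eq_zero _).2 fun u hu => ?_
      have h1 := congrFun (congrArg Prod.fst hu) a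
      have h1' := congrFun (congrArg Prod.fst hu) b
      have h2 := congrArg Prod.snd hu
      fin_cases i
      · simpa [T] using h1
      · simpa [T, hE, hab] using h1
      · simpa [T, hE, hab] using h1
      · have h3 : p u = 0 := by simpa [T] using h2
        simpa [T, hE, h3] using h1
      · simpa [T, hE] using h1'
  · intro g hg
    have hg1 : ∀ i u, ∃ v, g (E i u, 0) = (E i v, 0) := fun i u => hg (.inl i) u
    choose A hA using hg1
    have hsum (x : ι → U) : g (x, 0) = (fun i => A i (x i), 0) := by
      have hx : ((x, 0) : (ι → U) × R) = ∑ i, (E i (x i), 0) := by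
        ext j
        · simp [Prod.fst_sum, hE]
        · simp [Prod.snd_sum]
      rw [hx, map_sum]
      ext j
      · simp [hA, Prod.fst_sum, hE]
      · simp [hA, Prod.snd_sum]
    have hAeq (i : ι) (u : U) : A i u = A a u := by
      obtain ⟨v, hv⟩ := hg (.inr 0) u
      have hv' : g (fun _ => u, 0) = (fun _ => v, 0) := hv
      rw [hsum] at hv'
      have h := congrArg Prod.fst hv'
      exact (congrFun h i).trans (congrFun h a).symm
    let L : U →ₗ[F] U := LinearMap.proj a ∘ₗ LinearMap.fst F (ι → U) R ∘ₗ g ∘ₗ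
      LinearMap.inl F (ι → U) R ∘ₗ E a
    have hL (u : U) : L u = A a u := by simp [L, hA, hE]
    have hcomm (D : U →ₗ[F] U) (h : ∀ u, ∃ v, g (E a u + E b (D u), 0) = (E a v + E b (D v), 0))
        (u : U) : L (D u) = D (L u) := by
      obtain ⟨v, hv⟩ := h u
      rw [hsum] at hv
      have hv := congrArg Prod.fst hv
      have ha := congrFun hv a
      have hb := congrFun hv b
      simp only [Pi.add_apply, hE, if_true, if_neg hab, if_neg hab.symm, add_zero, zero_add,
        hAeq b] at ha hb
      rw [hL, hL, hb, ha]
    obtain ⟨c, hc⟩ := hBC L (hcomm B fun u => hg (.inr 1) u) (hcomm C fun u => hg (.inr 2) u)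
    have hU (x : ι → U) : g (x, 0) = (c • x, 0) := by
      rw [hsum]
      ext i
      · simp [hAeq i, ← hL, hc]
      · rfl
    have hR (y : R) : g (0, y) = (0, c • y) := by
      obtain ⟨v, hv⟩ := hg (.inr 3) (s y)
      obtain ⟨w, hw⟩ := hg (.inr 4) (s y)
      have hv' : g (E a (s y - s (p (s y))), p (s y)) = (E a (v - s (p v)), p v) := hv
      have hw' : g (E b (s y), p (s y)) = (E b w, p w) := hw
      simp only [hps, sub_self, map_zero] at hv' hw'
      have hsplit : ((E b (s y), y) : (ι → U) × R) = (E b (s y), 0) + (0, y) := by simp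
      rw [hsplit, map_add, hU, hv', Prod.mk_add_mk, zero_add, Prod.mk.injEq] at hw'
      obtain ⟨h1, h2⟩ := hw'
      have ha := congrFun h1 a
      have hb := congrFun h1 b
      simp only [Pi.add_apply, Pi.smul_apply, hE, if_true, if_neg hab, if_neg hab.symm, smul_zero,
        add_zero, zero_add] at ha hb
      rw [hv', ha, h2, ← hb, map_smul, hps, map_zero]
    refine ⟨c, fun x => ?_⟩
    have hx : x = (x.1, 0) + (0, x.2) := by simp
    rw [hx, map_add, hU, hR, smul_add]
    simp

/-- Let `F` be a finite field, `1 ≤ k`, `2k ≤ d`, `V = F^d`. There are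
`k`-dimensional subspaces `W₁, …, W_s` of `V` with `s ≤ d/k + 5` such that any
`g ∈ GL(V)` stabilizing every `W_i` is a scalar transformation. -/
theorem base_subspaces_general_linear (F : Type*) [Field F] [Fintype F]
    (d k : ℕ) (hk : 1 ≤ k) (hkd : 2 * k ≤ d) :
    ∃ (s : ℕ) (W : Fin s → Submodule F (Fin d → F)),
      (s : ℝ) ≤ (d : ℝ) / k + 5 ∧
      (∀ i, Module.finrank F (W i) = k) ∧
      ∀ g : (Fin d → F) ≃ₗ[F] (Fin d → F),
        (∀ i, (W i).map (g : (Fin d → F) →ₗ[F] (Fin d → F)) = W i) →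
        ∃ c : F, ∀ v, g v = c • v := by
  have : NeZero k := ⟨by omega⟩
  have hm : 2 ≤ d / k := (Nat.le_div_iff_mul_le hk).2 hkd
  have hr : d % k ≤ k := (Nat.mod_lt d hk).le
  have hinj : Function.Injective (Fin.castLE hr) := Fin.castLE_injective hr
  obtain ⟨f, hf, hfg⟩ := exists_embeddings_forall_invariant_imp_scalar
    (F := F) (U := Fin k → F) (R := Fin (d % k) → F) (ι := Fin (d / k))
    ⟨0, by omega⟩ ⟨1, by omega⟩ (by simp)
    (LinearMap.funLeft F F (fun i : Fin k => i - 1))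
    (LinearMap.single F (fun _ : Fin k => F) 0 ∘ₗ LinearMap.proj 0)
    (exists_smul_of_comm_cyclic_shift_of_comm_proj k)
    (LinearMap.funLeft F F (Fin.castLE hr))
    (Function.ExtendByZero.linearMap F (Fin.castLE hr))
    (fun x => by ext i; simp [LinearMap.funLeft_apply, hinj.extend_apply])
  let e : ((Fin (d / k) → Fin k → F) × (Fin (d % k) → F)) ≃ₗ[F] (Fin d → F) :=
    LinearEquiv.ofFinrankEq _ _ (by
      simp [Module.finrank_pi_fintype, Nat.div_add_mod'])
  refine ⟨d / k + 5, fun i => LinearMap.range (e.toLinearMap ∘ₗ f (finSumFinEquiv.symm i)),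
    ?_, fun i => ?_, fun g hg => ?_⟩
  · push_cast
    gcongr
    exact Nat.cast_div_le
  · rw [LinearMap.finrank_range_of_inj (f := e.toLinearMap ∘ₗ f _) (e.injective.comp (hf _)), Module.finrank_fin_fun]
  · obtain ⟨c, hc⟩ := hfg (e.symm.toLinearMap ∘ₗ g.toLinearMap ∘ₗ e.toLinearMap) (by
      intro i u
      have hmem := (hg (finSumFinEquiv i)).le
        (Submodule.mem_map_of_mem (LinearMap.mem_range_self _ u))
      obtain ⟨v, hv⟩ := hmem
      refine ⟨v, ?_⟩
      simp only [Equiv.symm_apply_apply, LinearMap.comp_apply, LinearEquiv.coe_coe] at hv ⊢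
      rw [← hv, e.symm_apply_apply])
    refine ⟨c, fun v => e.symm.injective ?_⟩
    simpa using hc (e.symm v)
end

section
/- Let F be a finite field, let V be an F-vector space of even dimension d = 2l equipped with a nondegenerate alternating bilinear form β, and let k be an integer with 2 ≤ k ≤ l. Then there exist k-dimensional totally isotropic subspaces W₁, …, W_s of V (i.e. β(x,y) = 0 for all x, y ∈ W_i) with s ≤ d/k + 10, such that every g ∈ GL(V) satisfying β(g x, g y) = β(x, y) for all x, y ∈ V and g(W_i) = W_i for all i = 1,…,s is a scalar transformation (i.e. g = λ·id_V for some λ ∈ F). -/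
/-- A pair of families `e`, `f` of vectors is symplectic for `β` if all values of `β` on pairs of
members vanish, except that `β (e i) (f i) = 1`. -/
structure IsSymplecticPair {F V ι : Type*} [Field F] [AddCommGroup V] [Module F V] [DecidableEq ι]
    (β : V →ₗ[F] V →ₗ[F] F) (e f : ι → V) : Prop where
  left_left : ∀ i j, β (e i) (e j) = 0
  right_right : ∀ i j, β (f i) (f j) = 0
  left_right : ∀ i j, β (e i) (f j) = if i = j then 1 else 0

section Symplectic

variable {F V : Type*} [Field F] [AddCommGroup V] [Module F V]

theorem IsSymplecticPair.right_left {ι : Type*} [DecidableEq ι] {β : V →ₗ[F] V →ₗ[F] F}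
    {e f : ι → V} (h : IsSymplecticPair β e f) (halt : β.IsAlt) (i j : ι) :
    β (f i) (e j) = if i = j then -1 else 0 := by
  rw [← halt.neg, h.left_right]
  split_ifs with h1 h2 h2 <;> simp_all

theorem IsSymplecticPair.comp {ι κ : Type*} [DecidableEq ι] [DecidableEq κ]
    {β : V →ₗ[F] V →ₗ[F] F} {e f : ι → V} (h : IsSymplecticPair β e f) {φ : κ → ι}
    (hφ : Function.Injective φ) : IsSymplecticPair β (e ∘ φ) (f ∘ φ) where
  left_left _ _ := h.left_left _ _
  right_right _ _ := h.right_right _ _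
  left_right i j := by simp [h.left_right, hφ.eq_iff]

/-- A family of vectors which has a dual family with respect to `β` is linearly independent. -/
theorem linearIndependent_of_apply_eq_ite {κ : Type*} [Fintype κ] [DecidableEq κ]
    {β : V →ₗ[F] V →ₗ[F] F} {w v : κ → V} {c : F} (hc : c ≠ 0)
    (h : ∀ i j, β (w i) (v j) = if i = j then c else 0) : LinearIndependent F w := by
  rw [Fintype.linearIndependent_iff]
  intro a ha i
  have := congrArg (fun x => β x (v i)) ha
  simpa [h, hc] using this

theorem apply_eq_zero_of_mem_span {κ : Type*} {β : V →ₗ[F] V →ₗ[F] F} {w v : κ → V}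
    (h : ∀ i j, β (w i) (v j) = 0) {x y : V} (hx : x ∈ Submodule.span F (Set.range w))
    (hy : y ∈ Submodule.span F (Set.range v)) : β x y = 0 := by
  induction hx, hy using Submodule.span_induction₂ with
  | mem_mem x y hx hy =>
    obtain ⟨i, rfl⟩ := hx
    obtain ⟨j, rfl⟩ := hy
    exact h i j
  | _ => simp_all

theorem exists_matrix_of_map_span_eq {κ : Type*} [Fintype κ] {w : κ → V} {g : V ≃ₗ[F] V}
    (h : (Submodule.span F (Set.range w)).map (g : V →ₗ[F] V) = Submodule.span F (Set.range w)) :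
    ∃ A : Matrix κ κ F, ∀ j, g (w j) = ∑ i, A i j • w i := by
  have hmem : ∀ j, g (w j) ∈ Submodule.span F (Set.range w) := fun j => by
    rw [← h]
    exact Submodule.mem_map_of_mem (Submodule.subset_span ⟨j, rfl⟩)
  simp only [Submodule.mem_span_range_iff_exists_fun] at hmem
  choose c hc using hmem
  exact ⟨fun i j => c j i, fun j => (hc j).symm⟩

/-- A space with a nondegenerate alternating form has symplectic pairs of every size up to half
its dimension. -/
theorem exists_isSymplecticPair_fin {β : V →ₗ[F] V →ₗ[F] F} [FiniteDimensional F V]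
    (halt : β.IsAlt) (hnd : ∀ x, (∀ y, β x y = 0) → x = 0) (t : ℕ)
    (ht : 2 * t ≤ Module.finrank F V) :
    ∃ e f : Fin t → V, IsSymplecticPair β e f := by
  induction t with
  | zero => exact ⟨0, 0, ⟨fun i => i.elim0, fun i => i.elim0, fun i => i.elim0⟩⟩
  | succ t ih =>
    obtain ⟨e, f, h⟩ := ih (by omega)
    have hfe := h.right_left halt
    let π : V → V := fun x => x - (∑ i, β x (f i) • e i + ∑ i, β (e i) x • f i)
    have hπe : ∀ x i, β (π x) (e i) = 0 := fun x i => by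
      simp only [π, map_sub, map_add, map_sum, map_smul, LinearMap.sub_apply, LinearMap.add_apply,
        LinearMap.sum_apply, LinearMap.smul_apply, h.left_left, hfe]
      simp [← halt.neg x (e i)]
    have hπf : ∀ x i, β (π x) (f i) = 0 := fun x i => by
      simp only [π, map_sub, map_add, map_sum, map_smul, LinearMap.sub_apply, LinearMap.add_apply,
        LinearMap.sum_apply, LinearMap.smul_apply, h.right_right, h.left_right]
      simp
    have heπ : ∀ x i, β (e i) (π x) = 0 := fun x i => by rw [← halt.neg, hπe, neg_zero]
    have hfπ : ∀ x i, β (f i) (π x) = 0 := fun x i => by rw [← halt.neg, hπf, neg_zero]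
    have hππ : ∀ x y, β (π x) (π y) = β (π x) y := fun x y => by
      conv_lhs => rw [show π y = y - (∑ i, β y (f i) • e i + ∑ i, β (e i) y • f i) from rfl]
      simp [hπe, hπf]
    obtain ⟨x, hx⟩ : ∃ x, π x ≠ 0 := by
      by_contra! hcon
      have htop : (⊤ : Submodule F V) ≤ Submodule.span F (Set.range (Sum.elim e f)) := by
        intro x _
        rw [sub_eq_zero.mp (hcon x)]
        exact add_mem
          (sum_mem fun i _ => Submodule.smul_mem _ _ (Submodule.subset_span ⟨Sum.inl i, rfl⟩))
          (sum_mem fun i _ => Submodule.smul_mem _ _ (Submodule.subset_span ⟨Sum.inr i, rfl⟩))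
      have hle := finrank_range_le_card (R := F) (Sum.elim e f)
      rw [Set.finrank, top_le_iff.mp htop, finrank_top] at hle
      simp at hle
      omega
    obtain ⟨y, hy⟩ : ∃ y, β (π x) y ≠ 0 := by
      by_contra! hcon
      exact hx (hnd _ hcon)
    refine ⟨Fin.cons (π x) e, Fin.cons ((β (π x) y)⁻¹ • π y) f, ?_, ?_, ?_⟩
    · intro i j
      induction i using Fin.cases <;> induction j using Fin.cases <;>
        simp [halt.self_eq_zero, hπe, heπ, h.left_left]
    · intro i j
      induction i using Fin.cases <;> induction j using Fin.cases <;>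
        simp [halt.self_eq_zero, hπf, hfπ, h.right_right]
    · intro i j
      induction i using Fin.cases <;> induction j using Fin.cases <;>
        simp [hππ, hy, hπf, heπ, h.left_right, Fin.succ_ne_zero, (Fin.succ_ne_zero _).symm]

theorem IsSymplecticPair.span_eq_top {ι : Type*} [Fintype ι] [DecidableEq ι]
    [FiniteDimensional F V] {β : V →ₗ[F] V →ₗ[F] F} {e f : ι → V} (h : IsSymplecticPair β e f)
    (hcard : Module.finrank F V = 2 * Fintype.card ι) :
    Submodule.span F (Set.range (Sum.elim e f)) = ⊤ := by
  have hli : LinearIndependent F (Sum.elim e f) := by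
    rw [Fintype.linearIndependent_iff]
    intro a ha
    simp only [Fintype.sum_sum_type, Sum.elim_inl, Sum.elim_inr] at ha
    rintro (i | i)
    · have := congrArg (fun x => β x (f i)) ha
      simpa [h.left_right, h.right_right] using this
    · have := congrArg (fun x => β (e i) x) ha
      simpa [h.left_right, h.left_left] using this
  exact hli.span_eq_top_of_card_eq_finrank' (by simp [hcard, two_mul])

/-- The vectors spanning the graph, over the span of `e`, of the linear map to the span of `f`
with matrix `S`. -/
def graphVec {κ : Type*} [Fintype κ] (e f : κ → V) (S : Matrix κ κ F) (j : κ) : V :=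
  e j + ∑ i, S i j • f i

theorem IsSymplecticPair.graphVec_graphVec {κ : Type*} [Fintype κ] [DecidableEq κ]
    {β : V →ₗ[F] V →ₗ[F] F} {e f : κ → V} (h : IsSymplecticPair β e f) (halt : β.IsAlt)
    {S : Matrix κ κ F} (hS : S.IsSymm) (i j : κ) :
    β (graphVec e f S i) (graphVec e f S j) = 0 := by
  simp [graphVec, h.left_left, h.right_right, h.left_right, h.right_left halt, hS.apply i j]

theorem IsSymplecticPair.graphVec_right {κ : Type*} [Fintype κ] [DecidableEq κ]
    {β : V →ₗ[F] V →ₗ[F] F} {e f : κ → V} (h : IsSymplecticPair β e f) (S : Matrix κ κ F)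
    (i j : κ) : β (graphVec e f S i) (f j) = if i = j then 1 else 0 := by
  simp [graphVec, h.right_right, h.left_right]

theorem IsSymplecticPair.left_graphVec {κ : Type*} [Fintype κ] [DecidableEq κ]
    {β : V →ₗ[F] V →ₗ[F] F} {e f : κ → V} (h : IsSymplecticPair β e f) (S : Matrix κ κ F)
    (i j : κ) : β (e i) (graphVec e f S j) = S i j := by
  simp [graphVec, h.left_left, h.left_right]

theorem IsSymplecticPair.mul_eq_mul_of_map_graphVec {κ : Type*} [Fintype κ] [DecidableEq κ]
    {β : V →ₗ[F] V →ₗ[F] F} {e f : κ → V} (h : IsSymplecticPair β e f) {S A B : Matrix κ κ F}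
    {g : V ≃ₗ[F] V} (hA : ∀ j, g (e j) = ∑ i, A i j • e i) (hB : ∀ j, g (f j) = ∑ i, B i j • f i)
    (hS : (Submodule.span F (Set.range (graphVec e f S))).map (g : V →ₗ[F] V) =
      Submodule.span F (Set.range (graphVec e f S))) : B * S = S * A := by
  obtain ⟨C, hC⟩ := exists_matrix_of_map_span_eq hS
  have hg : ∀ j, g (graphVec e f S j) = ∑ i, A i j • e i + ∑ m, S m j • ∑ i, B i m • f i :=
    fun j => by simp [graphVec, hA, hB]
  have hAC : A = C := by
    ext i j
    have := congrArg (fun x => β x (f i)) ((hg j).symm.trans (hC j))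
    simpa [h.left_right, h.right_right, h.graphVec_right] using this
  ext i j
  have := congrArg (fun x => β (e i) x) ((hg j).symm.trans (hC j))
  simp only [map_add, map_sum, map_smul, h.left_left, h.left_right, h.left_graphVec,
    smul_eq_mul] at this
  simp only [Matrix.mul_apply, hAC]
  simpa [mul_comm] using this

/-- The symmetric matrices of the involutions `i ↦ -i` and `i ↦ 1 - i` together with the matrix
unit at `(0, 0)` have only scalar matrices as their common centralizer. -/
theorem matrix_eq_ite_of_commute {k : ℕ} [NeZero k] {A : Matrix (Fin k) (Fin k) F}
    (hneg : A * Matrix.of (fun i j => if i = -j then 1 else 0) =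
      Matrix.of (fun i j => if i = -j then 1 else 0) * A)
    (hsub : A * Matrix.of (fun i j => if i = 1 - j then 1 else 0) =
      Matrix.of (fun i j => if i = 1 - j then 1 else 0) * A)
    (hsingle : A * Matrix.single 0 0 1 = Matrix.single 0 0 1 * A) (i j : Fin k) :
    A i j = if i = j then A 0 0 else 0 := by
  have h1 : ∀ i j, A i (-j) = A (-i) j := fun i j => by
    have := congrFun₂ hneg i j
    have hi : ∀ x : Fin k, i = -x ↔ -i = x := fun x => by
      rw [eq_neg_iff_add_eq_zero, neg_eq_iff_add_eq_zero]
    simpa [Matrix.mul_apply, hi] using this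
  have h2 : ∀ i j, A i (1 - j) = A (1 - i) j := fun i j => by
    have := congrFun₂ hsub i j
    have hi : ∀ x : Fin k, i = 1 - x ↔ 1 - i = x := fun x => by
      rw [eq_sub_iff_add_eq, sub_eq_iff_eq_add, add_comm, eq_comm]
    simpa [Matrix.mul_apply, hi] using this
  have h3 : ∀ i j, A (i + 1) (j + 1) = A i j := fun i j => by
    have := h2 (i + 1) (-j)
    rw [sub_neg_eq_add, add_comm 1 j, h1] at this
    rw [this]
    congr 1
    abel
  have h4 : ∀ i, i ≠ 0 → A i 0 = 0 := fun i hi => by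
    have := congrFun₂ hsingle i 0
    simpa [Matrix.mul_apply, Matrix.single_apply, hi.symm] using this
  obtain ⟨n, rfl⟩ : ∃ n, k = n + 1 := ⟨k - 1, by have := NeZero.ne k; omega⟩
  induction j using Fin.induction generalizing i with
  | zero =>
    split_ifs with hi
    · rw [hi]
    · exact h4 i hi
  | succ j ih =>
    have := h3 (i - 1) j.castSucc
    rw [sub_add_cancel, Fin.coeSucc_eq_succ] at this
    rw [this, ih]
    simp [sub_eq_iff_eq_add, Fin.coeSucc_eq_succ]

/-- The sum of the `j`-th vectors of all blocks, the last block being possibly incomplete. -/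
def blockSum {q k r : ℕ} (e : (Fin q × Fin k) ⊕ Fin r → V) (j : Fin k) : V :=
  ∑ m, e (Sum.inl (m, j)) + ∑ t : Fin r, if (t : ℕ) = j then e (Sum.inr t) else 0

theorem apply_blockSum_eq_zero {q k r : ℕ} {β : V →ₗ[F] V →ₗ[F] F}
    {e : (Fin q × Fin k) ⊕ Fin r → V} (h : ∀ i j, β (e i) (e j) = 0) (i j : Fin k) :
    β (blockSum e i) (blockSum e j) = 0 := by
  have hmem : ∀ j, blockSum e j ∈ Submodule.span F (Set.range e) := fun j => by
    refine add_mem (sum_mem fun m _ => Submodule.subset_span ⟨_, rfl⟩) (sum_mem fun t _ => ?_)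
    split_ifs
    · exact Submodule.subset_span ⟨_, rfl⟩
    · exact zero_mem _
  exact apply_eq_zero_of_mem_span h (hmem i) (hmem j)

theorem blockSum_apply {q k r : ℕ} {β : V →ₗ[F] V →ₗ[F] F} {c : F}
    {e f : (Fin q × Fin k) ⊕ Fin r → V} (hef : ∀ i j, β (e i) (f j) = if i = j then c else 0)
    (i j : Fin k) (m : Fin q) :
    β (blockSum e i) (f (Sum.inl (m, j))) = if i = j then c else 0 := by
  have hz : ∀ t : Fin r, β (if (t : ℕ) = i then e (Sum.inr t) else 0) (f (Sum.inl (m, j))) = 0 :=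
    fun t => by split_ifs <;> simp [hef]
  simp [blockSum, hef, hz, ite_and]

theorem map_eq_smul_of_blocks {q k r : ℕ} (hr : r ≤ k) {β : V →ₗ[F] V →ₗ[F] F} {c : F} (hc : c ≠ 0)
    {e f : (Fin q × Fin k) ⊕ Fin r → V} (hef : ∀ i j, β (e i) (f j) = if i = j then c else 0)
    {g : V ≃ₗ[F] V} (hg : ∀ x y, β (g x) (g y) = β x y)
    (he : ∀ m, (Submodule.span F (Set.range fun j => e (Sum.inl (m, j)))).map (g : V →ₗ[F] V) =
      Submodule.span F (Set.range fun j => e (Sum.inl (m, j))))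
    (hf : ∀ m, (Submodule.span F (Set.range fun j => f (Sum.inl (m, j)))).map (g : V →ₗ[F] V) =
      Submodule.span F (Set.range fun j => f (Sum.inl (m, j))))
    (hD : (Submodule.span F (Set.range (blockSum e))).map (g : V →ₗ[F] V) =
      Submodule.span F (Set.range (blockSum e)))
    {a : F} (m₀ : Fin q) (ha : ∀ j, g (e (Sum.inl (m₀, j))) = a • e (Sum.inl (m₀, j)))
    (i : (Fin q × Fin k) ⊕ Fin r) : g (e i) = a • e i := by
  choose A hA using fun m => exists_matrix_of_map_span_eq (he m)
  obtain ⟨C, hC⟩ := exists_matrix_of_map_span_eq hD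
  have hperp : ∀ t m j, β (g (e (Sum.inr t))) (f (Sum.inl (m, j))) = 0 := fun t m j => by
    have hmem : f (Sum.inl (m, j)) ∈
        (Submodule.span F (Set.range fun j => f (Sum.inl (m, j)))).map (g : V →ₗ[F] V) := by
      rw [hf m]
      exact Submodule.subset_span ⟨j, rfl⟩
    obtain ⟨y, hy, hyf⟩ := hmem
    rw [← hyf, LinearEquiv.coe_coe, hg]
    exact apply_eq_zero_of_mem_span (w := fun _ : Fin k => e (Sum.inr t)) (by simp [hef])
      (Submodule.subset_span ⟨j, rfl⟩) hy
  have hgD : ∀ j, g (blockSum e j) = ∑ m, g (e (Sum.inl (m, j))) +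
      ∑ t : Fin r, if (t : ℕ) = j then g (e (Sum.inr t)) else 0 := fun j => by
    simp [blockSum, apply_ite]
  have hAC : ∀ m i j, A m i j = C i j := fun m i j => by
    have := congrArg (fun x => β x (f (Sum.inl (m, i)))) ((hgD j).symm.trans (hC j))
    simpa [hA, hef, hperp, blockSum_apply hef, hc, ite_and, apply_ite, ite_apply] using this
  have hCa : ∀ i j, C i j = if i = j then a else 0 := fun i j => by
    have := congrArg (fun x => β x (f (Sum.inl (m₀, i)))) ((ha j).symm.trans (hA m₀ j))
    rw [eq_comm] at this
    simp only [map_smul, map_sum, LinearMap.smul_apply, LinearMap.sum_apply, hef, hAC] at this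
    rcases eq_or_ne i j with rfl | hij
    · simpa [hc] using this
    · simpa [hc, hij, hij.symm] using this
  have hinl : ∀ m j, g (e (Sum.inl (m, j))) = a • e (Sum.inl (m, j)) := fun m j => by
    simp [hA, hAC, hCa]
  rcases i with ⟨m, j⟩ | t
  · exact hinl m j
  · have := (hgD (t.castLE hr)).symm.trans (hC _)
    simp only [hCa, ite_smul, zero_smul, Finset.sum_ite_eq', Finset.mem_univ, if_true] at this
    simpa [hinl, blockSum, Finset.smul_sum, ← Fin.ext_iff] using this

end Symplectic

/-- Let `F` be a finite field, `V` of even dimension `d = 2l` with a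
nondegenerate alternating bilinear form `β`, and `2 ≤ k ≤ l`. There are `k`-dimensional
totally isotropic subspaces `W₁, …, W_s` of `V` with `s ≤ d/k + 10` such that any
`g ∈ GL(V)` preserving `β` and stabilizing every `W_i` is a scalar transformation. -/
theorem base_totally_isotropic_symplectic {F V : Type*} [Field F] [Fintype F]
    [AddCommGroup V] [Module F V] [FiniteDimensional F V]
    (d l k : ℕ) (hd : d = 2 * l) (hdim : Module.finrank F V = d)
    (hk2 : 2 ≤ k) (hkl : k ≤ l)
    (β : V →ₗ[F] V →ₗ[F] F)
    (halt : ∀ x, β x x = 0)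
    (hnd : ∀ x, (∀ y, β x y = 0) → x = 0) :
    ∃ (s : ℕ) (W : Fin s → Submodule F V),
      (s : ℝ) ≤ (d : ℝ) / k + 10 ∧
      (∀ i, Module.finrank F (W i) = k) ∧
      (∀ i, ∀ x ∈ W i, ∀ y ∈ W i, β x y = 0) ∧
      ∀ g : V ≃ₗ[F] V,
        (∀ x y, β (g x) (g y) = β x y) →
        (∀ i, (W i).map (g : V →ₗ[F] V) = W i) →
        ∃ c : F, ∀ v, g v = c • v := by
  have halt' : β.IsAlt := halt
  have : NeZero k := ⟨by omega⟩
  set q := l / k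
  set r := l % k
  have hq : 0 < q := Nat.div_pos hkl (by omega)
  have hr : r ≤ k := (Nat.mod_lt _ (by omega)).le
  have hcard : Fintype.card ((Fin q × Fin k) ⊕ Fin r) = l := by
    simp [q, r, Nat.div_add_mod']
  obtain ⟨e', f', h'⟩ := exists_isSymplecticPair_fin halt' hnd l (by omega)
  obtain ⟨e, f, h⟩ : ∃ e f : (Fin q × Fin k) ⊕ Fin r → V, IsSymplecticPair β e f :=
    ⟨_, _, h'.comp (Fintype.equivFinOfCardEq hcard).injective⟩
  have hspan := h.span_eq_top (by rw [hcard, hdim, hd])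
  let m₀ : Fin q := ⟨0, hq⟩
  have hb : ∀ m : Fin q, IsSymplecticPair β (fun j : Fin k => e (Sum.inl (m, j)))
      (fun j => f (Sum.inl (m, j))) := fun m => h.comp (φ := fun j => Sum.inl (m, j))
    fun i j hij => by simpa using hij
  let P : (Fin k → Fin k) → Matrix (Fin k) (Fin k) F := fun σ => .of fun i j =>
    if i = σ j then 1 else 0
  have hP : ∀ σ : Fin k → Fin k, Function.Involutive σ → (P σ).IsSymm := fun σ hσ => by
    ext i j
    have hij : j = σ i ↔ i = σ j := by rw [eq_comm, hσ.eq_iff]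
    simp [P, hij]
  let G : Matrix (Fin k) (Fin k) F → Fin k → V :=
    graphVec (fun j => e (Sum.inl (m₀, j))) (fun j => f (Sum.inl (m₀, j)))
  let S : Fin 4 → Matrix (Fin k) (Fin k) F :=
    ![1, P fun i => -i, P fun i => 1 - i, Matrix.single 0 0 1]
  have hS : ∀ n, (S n).IsSymm := by
    intro n
    fin_cases n
    · exact Matrix.isSymm_one
    · exact hP _ neg_neg
    · exact hP _ (sub_sub_cancel 1)
    · simp [S, Matrix.IsSymm]
  let w : (Fin q ⊕ Fin q) ⊕ (Unit ⊕ Unit) ⊕ Fin 4 → Fin k → V :=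
    Sum.elim (Sum.elim (fun m j => e (Sum.inl (m, j))) (fun m j => f (Sum.inl (m, j))))
      (Sum.elim (Sum.elim (fun _ => blockSum e) (fun _ => blockSum f)) (fun n => G (S n)))
  have hli : ∀ t, LinearIndependent F (w t) := by
    rintro ((m | m) | (_ | _) | n)
    · exact linearIndependent_of_apply_eq_ite one_ne_zero (hb m).left_right
    · exact linearIndependent_of_apply_eq_ite (neg_ne_zero.mpr one_ne_zero)
        ((hb m).right_left halt')
    · exact linearIndependent_of_apply_eq_ite one_ne_zero
        fun i j => blockSum_apply h.left_right i j m₀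
    · exact linearIndependent_of_apply_eq_ite (neg_ne_zero.mpr one_ne_zero)
        fun i j => blockSum_apply (h.right_left halt') i j m₀
    · exact linearIndependent_of_apply_eq_ite one_ne_zero ((hb m₀).graphVec_right (S n))
  have hiso : ∀ t i j, β (w t i) (w t j) = 0 := by
    rintro ((m | m) | (_ | _) | n)
    · exact (hb m).left_left
    · exact (hb m).right_right
    · exact apply_blockSum_eq_zero h.left_left
    · exact apply_blockSum_eq_zero h.right_right
    · exact (hb m₀).graphVec_graphVec halt' (hS n)
  let ε := Fintype.equivFin ((Fin q ⊕ Fin q) ⊕ (Unit ⊕ Unit) ⊕ Fin 4)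
  refine ⟨_, fun i => Submodule.span F (Set.range (w (ε.symm i))), ?_, fun i => ?_,
    fun i x hx y hy => apply_eq_zero_of_mem_span (hiso _) hx hy, fun g hg hW => ?_⟩
  · have hle : (q : ℝ) ≤ (l : ℝ) / k := Nat.cast_div_le
    simp only [Fintype.card_sum, Fintype.card_fin, Fintype.card_unit, hd]
    push_cast
    rw [mul_div_assoc]
    linarith
  · rw [finrank_span_eq_card (hli _), Fintype.card_fin]
  have hw : ∀ t, (Submodule.span F (Set.range (w t))).map (g : V →ₗ[F] V) =
      Submodule.span F (Set.range (w t)) := fun t => by simpa using hW (ε t)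
  have he : ∀ m, _ := fun m => hw (Sum.inl (Sum.inl m))
  have hf : ∀ m, _ := fun m => hw (Sum.inl (Sum.inr m))
  have hG : ∀ n, _ := fun n => hw (Sum.inr (Sum.inr n))
  obtain ⟨A, hA⟩ := exists_matrix_of_map_span_eq (he m₀)
  obtain ⟨B, hB⟩ := exists_matrix_of_map_span_eq (hf m₀)
  have hcomm : ∀ n, B * S n = S n * A := fun n =>
    (hb m₀).mul_eq_mul_of_map_graphVec hA hB (hG n)
  obtain rfl : B = A := by simpa [S] using hcomm 0
  obtain ⟨a, ha⟩ : ∃ a, ∀ i j, B i j = if i = j then a else 0 :=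
    ⟨_, matrix_eq_ite_of_commute (hcomm 1) (hcomm 2) (hcomm 3)⟩
  have hge := map_eq_smul_of_blocks hr one_ne_zero h.left_right hg he hf
    (hw (Sum.inr (Sum.inl (Sum.inl ())))) (a := a) m₀ fun j => by
      simpa [ha, w] using hA j
  have hgf := map_eq_smul_of_blocks hr (neg_ne_zero.mpr one_ne_zero) (h.right_left halt') hg hf he
    (hw (Sum.inr (Sum.inl (Sum.inr ())))) (a := a) m₀ fun j => by
      simpa [ha, w] using hB j
  refine ⟨a, fun v => ?_⟩
  have heq : (g : V →ₗ[F] V) = a • LinearMap.id := by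
    refine LinearMap.ext_on_range hspan ?_
    rintro (i | i)
    · simpa using hge i
    · simpa using hgf i
  exact LinearMap.congr_fun heq v
end
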